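/- (Interpolated Strichartz-type estimate) Let −1 ≤ α ≤ 1, 0 < ε < 1, 0 ≤ θ ≤ 1, p = 2/(1−θ) and 1/p + 1/p' = 1. Then ‖D_x^{θ(α/2 − ε)} W_α(t) ψ‖_{L^p(ℝ²)} ≤ C |t|^{−θ(5−2ε)/6} ‖ψ‖_{L^{p'}(ℝ²)}. -/

import Mathlib

open MeasureTheory Filter
open scoped ENNReal

noncomputable section

/-- Fourier transform on ℝ². -/
def FT2 (f : ℝ × ℝ → ℂ) : ℝ × ℝ → ℂ := fun p =>
  ∫ q : ℝ × ℝ, Complex.exp (-((2 * Real.pi * (p.1 * q.1 + p.2 * q.2) : ℝ) : ℂ) * Complex.I) * f q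

/-- Inverse Fourier transform on ℝ². -/
def IFT2 (f : ℝ × ℝ → ℂ) : ℝ × ℝ → ℂ := fun x =>
  ∫ p : ℝ × ℝ, Complex.exp (((2 * Real.pi * (x.1 * p.1 + x.2 * p.2) : ℝ) : ℂ) * Complex.I) * f p

/-- Homogeneous fractional derivative in `x`, symbol `|ξ|^s`. -/
def Dx (s : ℝ) (f : ℝ × ℝ → ℂ) : ℝ × ℝ → ℂ :=
  IFT2 fun p => ((|p.1| ^ s : ℝ) : ℂ) * FT2 f p

/-- Fractional derivative in `x` with complex order `β`. -/
def DxC (β : ℂ) (f : ℝ × ℝ → ℂ) : ℝ × ℝ → ℂ :=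
  IFT2 fun p => (((|p.1| : ℝ) : ℂ) ^ β) * FT2 f p

/-- Inhomogeneous derivative `J_x^s = (1+|D_x|²)^{s/2}`. -/
def Jx (s : ℝ) (f : ℝ × ℝ → ℂ) : ℝ × ℝ → ℂ :=
  IFT2 fun p => (((1 + p.1 ^ 2) ^ (s / 2) : ℝ) : ℂ) * FT2 f p

/-- Real-valued version of `J_x^s`. -/
def JxR (s : ℝ) (f : ℝ × ℝ → ℝ) : ℝ × ℝ → ℝ := fun z =>
  (Jx s (fun w => ((f w : ℝ) : ℂ)) z).re

/-- The unitary group `W_α(t)` with symbol `e^{-it(ξ³+sgn(ξ)|ξ|^α η²)}`. -/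
def Wgrp (α t : ℝ) (f : ℝ × ℝ → ℂ) : ℝ × ℝ → ℂ :=
  IFT2 fun p =>
    Complex.exp (-Complex.I * (t : ℂ) *
      ((p.1 ^ 3 + Real.sign p.1 * |p.1| ^ α * p.2 ^ 2 : ℝ) : ℂ)) * FT2 f p

/-- The operator `ℋ D_x^α` (Hilbert transform composed with fractional derivative in `x`). -/
def HDa (α : ℝ) (f : ℝ × ℝ → ℂ) : ℝ × ℝ → ℂ :=
  IFT2 fun p => (-Complex.I) * ((Real.sign p.1 * |p.1| ^ α : ℝ) : ℂ) * FT2 f p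

/-- Anisotropic Sobolev norm of `H^{s₁,s₂}(ℝ²)`. -/
def HNorm2 (s₁ s₂ : ℝ) (f : ℝ × ℝ → ℂ) : ℝ :=
  Real.sqrt (∫ p : ℝ × ℝ, ((1 + p.1 ^ 2) ^ s₁ + (1 + p.2 ^ 2) ^ s₂) * ‖FT2 f p‖ ^ 2)

/-- Membership in the anisotropic Sobolev space `H^{s₁,s₂}(ℝ²)`. -/
def MemH (s₁ s₂ : ℝ) (f : ℝ × ℝ → ℂ) : Prop :=
  Integrable (fun p : ℝ × ℝ => ((1 + p.1 ^ 2) ^ s₁ + (1 + p.2 ^ 2) ^ s₂) * ‖FT2 f p‖ ^ 2) volume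

/-- Homogeneous anisotropic Sobolev norm. -/
def HdotNorm (s₁ s₂ : ℝ) (f : ℝ × ℝ → ℂ) : ℝ :=
  Real.sqrt (∫ p : ℝ × ℝ, (|p.1| ^ (2 * s₁) + |p.2| ^ (2 * s₂)) * ‖FT2 f p‖ ^ 2)

/-- `u` solves `u_t = u_{xxx} - ℋ D_x^α u_{yy} + u u_x` (complex-valued version). -/
def IsSol (α : ℝ) (u : ℝ → ℝ × ℝ → ℂ) : Prop :=
  ∀ t : ℝ, ∀ z : ℝ × ℝ,
    HasDerivAt (fun s => u s z)
      (iteratedDeriv 3 (fun a => u t (a, z.2)) z.1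
        - HDa α (fun w => iteratedDeriv 2 (fun b => u t (w.1, b)) w.2) z
        + u t z * deriv (fun a => u t (a, z.2)) z.1) t

/-- `u` solves `u_t = u_{xxx} - ℋ D_x^α u_{yy} + u u_x` (real-valued version). -/
def IsSolR (α : ℝ) (u : ℝ → ℝ × ℝ → ℝ) : Prop :=
  ∀ t : ℝ, ∀ z : ℝ × ℝ,
    HasDerivAt (fun s => u s z)
      (iteratedDeriv 3 (fun a => u t (a, z.2)) z.1
        - (HDa α (fun w => ((iteratedDeriv 2 (fun b => u t (w.1, b)) w.2 : ℝ) : ℂ)) z).re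
        + u t z * deriv (fun a => u t (a, z.2)) z.1) t

/-- `u` solves the equation on the time interval `[0,T]` (real-valued version). -/
def IsSolROn (α T : ℝ) (u : ℝ → ℝ × ℝ → ℝ) : Prop :=
  ∀ t ∈ Set.Icc (0 : ℝ) T, ∀ z : ℝ × ℝ,
    HasDerivAt (fun s => u s z)
      (iteratedDeriv 3 (fun a => u t (a, z.2)) z.1
        - (HDa α (fun w => ((iteratedDeriv 2 (fun b => u t (w.1, b)) w.2 : ℝ) : ℂ)) z).re
        + u t z * deriv (fun a => u t (a, z.2)) z.1) t

/-- `w` solves the inhomogeneous linear equation `∂_t w = w_{xxx} - ℋ D_x^α w_{yy} + F` on `[0,T]`. -/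
def IsSolLin (α T : ℝ) (w F : ℝ → ℝ × ℝ → ℂ) : Prop :=
  ∀ t ∈ Set.Icc (0 : ℝ) T, ∀ z : ℝ × ℝ,
    HasDerivAt (fun s => w s z)
      (iteratedDeriv 3 (fun a => w t (a, z.2)) z.1
        - HDa α (fun q => iteratedDeriv 2 (fun b => w t (q.1, b)) q.2) z
        + F t z) t

/-- Integration by parts bound for an amplitude of bounded variation. -/
theorem norm_integral_amplitude_le {a b M V : ℝ} (hab : a ≤ b) {A A' F : ℝ → ℂ}
    (hA : ∀ x ∈ Set.Icc a b, HasDerivAt A (A' x) x) (hA' : ContinuousOn A' (Set.Icc a b))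
    (hF : ContinuousOn F (Set.Icc a b)) (hM : ∀ x ∈ Set.Icc a b, ‖∫ y in a..x, F y‖ ≤ M)
    (hV : ∫ x in a..b, ‖A' x‖ ≤ V) :
    ‖∫ x in a..b, A x * F x‖ ≤ M * (‖A b‖ + V) := by
  have hM0 : 0 ≤ M := (norm_nonneg _).trans (hM a ⟨le_rfl, hab⟩)
  have huI := Set.uIcc_of_le hab
  have hFi : IntervalIntegrable F volume a b := by
    apply ContinuousOn.intervalIntegrable; rwa [huI]
  have hG : ∀ x ∈ Set.Ioo a b, HasDerivAt (fun x => ∫ y in a..x, F y) (F x) x := fun x hx =>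
    intervalIntegral.integral_hasDerivAt_right
      (hFi.mono_set (by
        rw [huI, Set.uIcc_of_le hx.1.le]; exact Set.Icc_subset_Icc le_rfl hx.2.le))
      ((hF.mono Set.Ioo_subset_Icc_self).stronglyMeasurableAtFilter isOpen_Ioo x hx)
      (hF.continuousAt (Icc_mem_nhds hx.1 hx.2))
  have hA'i : IntervalIntegrable A' volume a b := by
    apply ContinuousOn.intervalIntegrable; rwa [huI]
  rw [intervalIntegral.integral_mul_deriv_eq_deriv_mul_of_hasDerivAt (u := A)
    (v := fun x => ∫ y in a..x, F y) (u' := A') (v' := F)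
    (by rw [huI]; exact fun x hx => (hA x hx).continuousAt.continuousWithinAt)
    (intervalIntegral.continuousOn_primitive_interval' hFi Set.left_mem_uIcc)
    (fun x hx => by
      rw [min_eq_left hab, max_eq_right hab] at hx; exact hA x (Set.Ioo_subset_Icc_self hx))
    (fun x hx => by rw [min_eq_left hab, max_eq_right hab] at hx; exact hG x hx) hA'i hFi]
  have h1 : ‖∫ x in a..b, A' x * ∫ y in a..x, F y‖ ≤ ∫ x in a..b, ‖A' x‖ * M := by
    apply intervalIntegral.norm_integral_le_of_norm_le hab
    · filter_upwards with x hx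
      rw [norm_mul]
      exact mul_le_mul_of_nonneg_left (hM x ⟨hx.1.le, hx.2⟩) (norm_nonneg _)
    · exact hA'i.norm.mul_const _
  rw [intervalIntegral.integral_mul_const] at h1
  have h2 := norm_sub_le (A b * ∫ y in a..b, F y) (∫ x in a..b, A' x * ∫ y in a..x, F y)
  have h3 : ‖A b * ∫ y in a..b, F y‖ ≤ ‖A b‖ * M := by
    rw [norm_mul]
    exact mul_le_mul_of_nonneg_left (hM b ⟨hab, le_rfl⟩) (norm_nonneg _)
  simp only [intervalIntegral.integral_same, mul_zero, sub_zero]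
  nlinarith [mul_le_mul_of_nonneg_left hV hM0]

theorem norm_integral_cexp_le_length {a b : ℝ} (hab : a ≤ b) (φ : ℝ → ℝ) :
    ‖∫ x in a..b, Complex.exp (φ x * Complex.I)‖ ≤ b - a := by
  have := intervalIntegral.norm_integral_le_of_norm_le_const (a := a) (b := b) (C := 1)
    (f := fun x => Complex.exp (φ x * Complex.I))
    (fun x _ => (Complex.norm_exp_ofReal_mul_I _).le)
  rwa [one_mul, abs_of_nonneg (by linarith)] at this

/-- Conjugation symmetry of oscillatory integrals. -/
theorem norm_integral_cexp_neg {a b : ℝ} (φ : ℝ → ℝ) :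
    ‖∫ x in a..b, Complex.exp (((-φ x : ℝ) : ℂ) * Complex.I)‖ =
      ‖∫ x in a..b, Complex.exp (φ x * Complex.I)‖ := by
  rw [← Complex.norm_conj (∫ x in a..b, Complex.exp (φ x * Complex.I)),
    ← intervalIntegral.intervalIntegral_conj]
  congr 2
  funext x
  rw [← Complex.exp_conj]
  simp

/-- First derivative test for a phase with monotone derivative. -/
theorem norm_integral_cexp_le_first {a b l : ℝ} (hab : a ≤ b) (hl : 0 < l) {φ φ₁ φ₂ : ℝ → ℝ}
    (h0 : ∀ x ∈ Set.Icc a b, HasDerivAt φ (φ₁ x) x)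
    (h1 : ∀ x ∈ Set.Icc a b, HasDerivAt φ₁ (φ₂ x) x)
    (h2 : ContinuousOn φ₂ (Set.Icc a b)) (hpos : ∀ x ∈ Set.Icc a b, 0 ≤ φ₂ x)
    (hl1 : ∀ x ∈ Set.Icc a b, l ≤ |φ₁ x|) :
    ‖∫ x in a..b, Complex.exp (φ x * Complex.I)‖ ≤ 4 / l := by
  have hne : ∀ x ∈ Set.Icc a b, φ₁ x ≠ 0 := fun x hx h => by
    have := hl1 x hx; rw [h, abs_zero] at this; linarith
  have hc1 : ContinuousOn φ₁ (Set.Icc a b) := fun x hx => (h1 x hx).continuousAt.continuousWithinAt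
  have hc0 : ContinuousOn φ (Set.Icc a b) := fun x hx => (h0 x hx).continuousAt.continuousWithinAt
  have huI := Set.uIcc_of_le hab
  have hu0 : ∀ x ∈ Set.Icc a b, HasDerivAt (fun x => -(φ₁ x)⁻¹) (φ₂ x / φ₁ x ^ 2) x :=
    fun x hx => ((h1 x hx).fun_inv (hne x hx)).fun_neg.congr_deriv (by ring)
  have hu : ∀ x ∈ Set.uIcc a b, HasDerivAt (fun x => ((-(φ₁ x)⁻¹ : ℝ) : ℂ) * Complex.I)
      (((φ₂ x / φ₁ x ^ 2 : ℝ) : ℂ) * Complex.I) x := fun x hx => by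
    rw [huI] at hx
    exact (hu0 x hx).ofReal_comp.mul_const Complex.I
  have hv : ∀ x ∈ Set.uIcc a b, HasDerivAt (fun x => Complex.exp (φ x * Complex.I))
      (Complex.exp (φ x * Complex.I) * ((φ₁ x : ℂ) * Complex.I)) x := fun x hx => by
    rw [huI] at hx
    exact ((h0 x hx).ofReal_comp.mul_const Complex.I).cexp
  have hq : ContinuousOn (fun x => φ₂ x / φ₁ x ^ 2) (Set.Icc a b) :=
    h2.div (hc1.pow 2) (fun x hx => pow_ne_zero 2 (hne x hx))
  have hqi : IntervalIntegrable (fun x => φ₂ x / φ₁ x ^ 2) volume a b := by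
    apply ContinuousOn.intervalIntegrable; rwa [huI]
  have hexp : ContinuousOn (fun x => Complex.exp (φ x * Complex.I)) (Set.Icc a b) := by
    fun_prop
  have hv' : IntervalIntegrable (fun x => Complex.exp (φ x * Complex.I) * ((φ₁ x : ℂ) * Complex.I))
      volume a b := by
    apply ContinuousOn.intervalIntegrable; rw [huI]; fun_prop
  have hu' : IntervalIntegrable (fun x => ((φ₂ x / φ₁ x ^ 2 : ℝ) : ℂ) * Complex.I) volume a b := by
    apply ContinuousOn.intervalIntegrable; rw [huI]; fun_prop
  have key := intervalIntegral.integral_mul_deriv_eq_deriv_mul hu hv hu' hv'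
  have hL : ∫ x in a..b, (((-(φ₁ x)⁻¹ : ℝ) : ℂ) * Complex.I) *
      (Complex.exp (φ x * Complex.I) * ((φ₁ x : ℂ) * Complex.I)) =
      ∫ x in a..b, Complex.exp (φ x * Complex.I) := by
    apply intervalIntegral.integral_congr
    intro x hx
    rw [huI] at hx
    have : (φ₁ x : ℂ) ≠ 0 := by exact_mod_cast hne x hx
    have hI := Complex.I_mul_I
    simp only [Complex.ofReal_neg, Complex.ofReal_inv]
    field_simp
    rw [Complex.I_sq]; ring
  rw [hL] at key
  rw [key]
  have hinv : ∀ x ∈ Set.Icc a b, |(φ₁ x)⁻¹| ≤ 1 / l := fun x hx => by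
    rw [abs_inv, one_div]; exact inv_anti₀ hl (hl1 x hx)
  have hb1 : ∀ x ∈ Set.Icc a b,
      ‖(((-(φ₁ x)⁻¹ : ℝ) : ℂ) * Complex.I) * Complex.exp (φ x * Complex.I)‖ ≤ 1 / l := fun x hx => by
    rw [norm_mul, norm_mul, Complex.norm_exp_ofReal_mul_I, Complex.norm_I, Complex.norm_real,
      mul_one, mul_one, norm_neg, Real.norm_eq_abs]
    exact hinv x hx
  have h_int : ∫ x in a..b, φ₂ x / φ₁ x ^ 2 = (φ₁ a)⁻¹ - (φ₁ b)⁻¹ := by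
    have := intervalIntegral.integral_eq_sub_of_hasDerivAt (f := fun x => -(φ₁ x)⁻¹)
      (f' := fun x => φ₂ x / φ₁ x ^ 2) (a := a) (b := b)
      (fun x hx => hu0 x (by rwa [huI] at hx)) hqi
    rw [this]; ring
  have hb2 : ‖∫ x in a..b, (((φ₂ x / φ₁ x ^ 2 : ℝ) : ℂ) * Complex.I) *
      Complex.exp (φ x * Complex.I)‖ ≤ 2 / l := by
    calc _ ≤ ∫ x in a..b, φ₂ x / φ₁ x ^ 2 := by
          apply intervalIntegral.norm_integral_le_of_norm_le hab
          · filter_upwards with x hx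
            rw [norm_mul, norm_mul, Complex.norm_exp_ofReal_mul_I, Complex.norm_I, Complex.norm_real,
              mul_one, mul_one, Real.norm_of_nonneg]
            exact div_nonneg (hpos x ⟨hx.1.le, hx.2⟩) (sq_nonneg _)
          · exact hqi
      _ = (φ₁ a)⁻¹ - (φ₁ b)⁻¹ := h_int
      _ ≤ |(φ₁ a)⁻¹| + |(φ₁ b)⁻¹| := by
          linarith [le_abs_self (φ₁ a)⁻¹, neg_abs_le (φ₁ b)⁻¹]
      _ ≤ 1 / l + 1 / l := add_le_add (hinv a ⟨le_rfl, hab⟩) (hinv b ⟨hab, le_rfl⟩)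
      _ = 2 / l := by ring
  refine (norm_sub_le _ _).trans ((add_le_add (norm_sub_le _ _) hb2).trans ?_)
  have e1 := hb1 a ⟨le_rfl, hab⟩
  have e2 := hb1 b ⟨hab, le_rfl⟩
  calc _ ≤ 1 / l + 1 / l + 2 / l := by linarith
    _ = 4 / l := by ring

/-- A function with derivative at least `μ` is pinched by linear functions around some point. -/
theorem exists_pinch_of_deriv_ge {a b μ : ℝ} (hab : a ≤ b) {f f' : ℝ → ℝ}
    (hf : ∀ x ∈ Set.Icc a b, HasDerivAt f (f' x) x) (hf' : ∀ x ∈ Set.Icc a b, μ ≤ f' x) :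
    ∃ c ∈ Set.Icc a b, (∀ x ∈ Set.Ioc c b, μ * (x - c) ≤ f x) ∧
      ∀ x ∈ Set.Ico a c, f x ≤ -(μ * (c - x)) := by
  have hc : ContinuousOn f (Set.Icc a b) := fun x hx => (hf x hx).continuousAt.continuousWithinAt
  have hinc : ∀ x ∈ Set.Icc a b, ∀ y ∈ Set.Icc a b, x ≤ y → μ * (y - x) ≤ f y - f x :=
    (convex_Icc a b).mul_sub_le_image_sub_of_le_deriv hc
      (fun x hx => (hf x (interior_subset hx)).differentiableAt.differentiableWithinAt)
      (fun x hx => by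
        rw [(hf x (interior_subset hx)).deriv]; exact hf' x (interior_subset hx))
  rcases le_or_gt 0 (f b) with hfb | hfb
  · rcases le_or_gt (f a) 0 with hfa | hfa
    · obtain ⟨c, hcm, hc0⟩ := intermediate_value_Icc hab hc ⟨hfa, hfb⟩
      refine ⟨c, hcm, fun x hx => ?_, fun x hx => ?_⟩
      · linarith [hinc c hcm x ⟨hcm.1.trans hx.1.le, hx.2⟩ hx.1.le]
      · linarith [hinc x ⟨hx.1, hx.2.le.trans hcm.2⟩ c hcm hx.2.le]
    · refine ⟨a, ⟨le_rfl, hab⟩, fun x hx => ?_, fun x hx => ?_⟩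
      · linarith [hinc a ⟨le_rfl, hab⟩ x ⟨hx.1.le, hx.2⟩ hx.1.le]
      · exact absurd hx.2 (not_lt.2 hx.1)
  · refine ⟨b, ⟨hab, le_rfl⟩, fun x hx => ?_, fun x hx => ?_⟩
    · exact absurd hx.1 (not_lt.2 hx.2)
    · linarith [hinc x ⟨hx.1, hx.2.le⟩ b ⟨hab, le_rfl⟩ hx.2.le]

theorem norm_integral_split_le {a b c A B : ℝ} {F : ℝ → ℂ} (hac : a ≤ c) (hcb : c ≤ b)
    (hF : ContinuousOn F (Set.Icc a b)) (h1 : ‖∫ x in a..c, F x‖ ≤ A)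
    (h2 : ‖∫ x in c..b, F x‖ ≤ B) : ‖∫ x in a..b, F x‖ ≤ A + B := by
  have i1 : IntervalIntegrable F volume a c := by
    apply ContinuousOn.intervalIntegrable; rw [Set.uIcc_of_le hac]
    exact hF.mono (Set.Icc_subset_Icc le_rfl hcb)
  have i2 : IntervalIntegrable F volume c b := by
    apply ContinuousOn.intervalIntegrable; rw [Set.uIcc_of_le hcb]
    exact hF.mono (Set.Icc_subset_Icc hac le_rfl)
  rw [← intervalIntegral.integral_add_adjacent_intervals i1 i2]
  exact (norm_add_le _ _).trans (add_le_add h1 h2)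

/-- Van der Corput's lemma for the second derivative. -/
theorem norm_integral_cexp_le_second {a b μ : ℝ} (hab : a ≤ b) (hμ : 0 < μ) {φ φ₁ φ₂ : ℝ → ℝ}
    (h0 : ∀ x ∈ Set.Icc a b, HasDerivAt φ (φ₁ x) x)
    (h1 : ∀ x ∈ Set.Icc a b, HasDerivAt φ₁ (φ₂ x) x)
    (h2 : ContinuousOn φ₂ (Set.Icc a b)) (hpos : ∀ x ∈ Set.Icc a b, μ ≤ φ₂ x) {r : ℝ} (hr : 0 < r) :
    ‖∫ x in a..b, Complex.exp (φ x * Complex.I)‖ ≤ 2 * (r + 4 / (μ * r)) := by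
  obtain ⟨c, hc, hcr, hcl⟩ := exists_pinch_of_deriv_ge hab h1 hpos
  have hc0 : ContinuousOn φ (Set.Icc a b) := fun x hx => (h0 x hx).continuousAt.continuousWithinAt
  have hF : ContinuousOn (fun x => Complex.exp (φ x * Complex.I)) (Set.Icc a b) := by fun_prop
  have hμr : 0 < μ * r := by positivity
  have h4 : 0 < 4 / (μ * r) := by positivity
  rw [two_mul]
  apply norm_integral_split_le hc.1 hc.2 hF
  · rcases le_or_gt (c - a) r with h | h
    · exact (norm_integral_cexp_le_length hc.1 φ).trans (by linarith)
    · rw [add_comm]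
      apply norm_integral_split_le (c := c - r) (by linarith) (by linarith)
        (hF.mono (Set.Icc_subset_Icc le_rfl hc.2))
      · have hs : Set.Icc a (c - r) ⊆ Set.Icc a b :=
          Set.Icc_subset_Icc le_rfl (by linarith [hc.2])
        apply norm_integral_cexp_le_first (by linarith) hμr (fun x hx => h0 x (hs hx))
          (fun x hx => h1 x (hs hx)) (h2.mono hs) (fun x hx => hμ.le.trans (hpos x (hs hx)))
        intro x hx
        have := hcl x ⟨hx.1, by linarith [hx.2]⟩
        rw [le_abs]; right
        nlinarith [hx.2]
      · exact (norm_integral_cexp_le_length (by linarith) φ).trans (by linarith)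
  · rcases le_or_gt (b - c) r with h | h
    · exact (norm_integral_cexp_le_length hc.2 φ).trans (by linarith)
    · apply norm_integral_split_le (c := c + r) (by linarith) (by linarith)
        (hF.mono (Set.Icc_subset_Icc hc.1 le_rfl))
      · exact (norm_integral_cexp_le_length (by linarith) φ).trans (by linarith)
      · have hs : Set.Icc (c + r) b ⊆ Set.Icc a b :=
          Set.Icc_subset_Icc (by linarith [hc.1]) le_rfl
        apply norm_integral_cexp_le_first (by linarith) hμr (fun x hx => h0 x (hs hx))
          (fun x hx => h1 x (hs hx)) (h2.mono hs) (fun x hx => hμ.le.trans (hpos x (hs hx)))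
        intro x hx
        have := hcr x ⟨by linarith [hx.1], hx.2⟩
        rw [le_abs]; left
        nlinarith [hx.1]

/-- Van der Corput's lemma for the third derivative. -/
theorem norm_integral_cexp_le_third {a b μ : ℝ} (hab : a ≤ b) (hμ : 0 < μ) {φ φ₁ φ₂ φ₃ : ℝ → ℝ}
    (h0 : ∀ x ∈ Set.Icc a b, HasDerivAt φ (φ₁ x) x)
    (h1 : ∀ x ∈ Set.Icc a b, HasDerivAt φ₁ (φ₂ x) x)
    (h2 : ∀ x ∈ Set.Icc a b, HasDerivAt φ₂ (φ₃ x) x)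
    (hpos : ∀ x ∈ Set.Icc a b, μ ≤ φ₃ x) {r : ℝ} (hr : 0 < r) :
    ‖∫ x in a..b, Complex.exp (φ x * Complex.I)‖ ≤ 2 * (r + 2 * (r + 4 / (μ * r * r))) := by
  obtain ⟨c, hc, hcr, hcl⟩ := exists_pinch_of_deriv_ge hab h2 hpos
  have hc0 : ContinuousOn φ (Set.Icc a b) := fun x hx => (h0 x hx).continuousAt.continuousWithinAt
  have hc2 : ContinuousOn φ₂ (Set.Icc a b) := fun x hx => (h2 x hx).continuousAt.continuousWithinAt
  have hF : ContinuousOn (fun x => Complex.exp (φ x * Complex.I)) (Set.Icc a b) := by fun_prop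
  have hμr : 0 < μ * r := by positivity
  have h4 : 0 < 4 / (μ * r * r) := by positivity
  rw [two_mul]
  apply norm_integral_split_le hc.1 hc.2 hF
  · rcases le_or_gt (c - a) r with h | h
    · exact (norm_integral_cexp_le_length hc.1 φ).trans (by linarith)
    · rw [add_comm]
      apply norm_integral_split_le (c := c - r) (by linarith) (by linarith)
        (hF.mono (Set.Icc_subset_Icc le_rfl hc.2))
      · have hs : Set.Icc a (c - r) ⊆ Set.Icc a b :=
          Set.Icc_subset_Icc le_rfl (by linarith [hc.2])
        rw [← norm_integral_cexp_neg]
        apply norm_integral_cexp_le_second (φ₁ := fun x => -φ₁ x) (φ₂ := fun x => -φ₂ x)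
          (by linarith) hμr (fun x hx => (h0 x (hs hx)).fun_neg)
          (fun x hx => (h1 x (hs hx)).fun_neg) (hc2.mono hs).neg _ hr
        intro x hx
        have := hcl x ⟨hx.1, by linarith [hx.2]⟩
        nlinarith [hx.2]
      · exact (norm_integral_cexp_le_length (by linarith) φ).trans (by linarith)
  · rcases le_or_gt (b - c) r with h | h
    · exact (norm_integral_cexp_le_length hc.2 φ).trans (by linarith)
    · apply norm_integral_split_le (c := c + r) (by linarith) (by linarith)
        (hF.mono (Set.Icc_subset_Icc hc.1 le_rfl))
      · exact (norm_integral_cexp_le_length (by linarith) φ).trans (by linarith)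
      · have hs : Set.Icc (c + r) b ⊆ Set.Icc a b :=
          Set.Icc_subset_Icc (by linarith [hc.1]) le_rfl
        apply norm_integral_cexp_le_second (by linarith) hμr (fun x hx => h0 x (hs hx))
          (fun x hx => h1 x (hs hx)) (hc2.mono hs) _ hr
        intro x hx
        have := hcr x ⟨by linarith [hx.1], hx.2⟩
        nlinarith [hx.1]

/-- Uniform bound for the oscillatory integral with the phase of the fundamental solution. -/
theorem norm_integral_cexp_phase_le {α T X c l a b : ℝ} (hα1 : -1 ≤ α) (hT : 0 < T)
    (hc : 0 ≤ c) (hl : 0 < l) (hlT : T * l ^ 3 = 1) (hla : l ≤ a) (hab : a ≤ b) :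
    ‖∫ x in a..b, Complex.exp (((T * x ^ 3 + X * x - c * x ^ (-α) : ℝ) : ℂ) * Complex.I)‖ ≤
      22 * l := by
  have hpos : ∀ x ∈ Set.Icc a b, 0 < x := fun x hx => hl.trans_le (hla.trans hx.1)
  have hp : ∀ (q : ℝ), ∀ x ∈ Set.Icc a b, HasDerivAt (fun x : ℝ => x ^ q) (q * x ^ (q - 1)) x :=
    fun q x hx => Real.hasDerivAt_rpow_const (Or.inl (hpos x hx).ne')
  have h0 : ∀ x ∈ Set.Icc a b, HasDerivAt (fun x => T * x ^ 3 + X * x - c * x ^ (-α))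
      (T * (3 * x ^ 2) + X - c * (-α * x ^ (-α - 1))) x := fun x hx => by
    have e1 := (hasDerivAt_pow 3 x).const_mul T
    have e2 := (hasDerivAt_id x).const_mul X
    have := (e1.fun_add e2).fun_sub ((hp (-α) x hx).const_mul c)
    simpa using this
  have h1 : ∀ x ∈ Set.Icc a b, HasDerivAt (fun x => T * (3 * x ^ 2) + X - c * (-α * x ^ (-α - 1)))
      (T * (6 * x) - c * (-α * ((-α - 1) * x ^ (-α - 1 - 1)))) x := fun x hx => by
    have e1 := (((hasDerivAt_pow 2 x).const_mul 3).const_mul T).add_const X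
    have := e1.fun_sub (((hp (-α - 1) x hx).const_mul (-α)).const_mul c)
    refine this.congr_deriv ?_
    push_cast; ring
  have h2 : ∀ x ∈ Set.Icc a b,
      HasDerivAt (fun x => T * (6 * x) - c * (-α * ((-α - 1) * x ^ (-α - 1 - 1))))
      (T * 6 - c * (-α * ((-α - 1) * ((-α - 1 - 1) * x ^ (-α - 1 - 1 - 1))))) x := fun x hx => by
    have e1 := ((hasDerivAt_id x).const_mul 6).const_mul T
    have := e1.fun_sub ((((hp (-α - 1 - 1) x hx).const_mul (-α - 1)).const_mul (-α)).const_mul c)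
    simpa using this
  have h4 : 4 / (T * l * l) = 4 * l := by
    rw [div_eq_iff (by positivity)]; linear_combination (-4 : ℝ) * hlT
  rcases le_or_gt α 0 with hα | hα
  · have := norm_integral_cexp_le_second hab (mul_pos hT hl) h0 h1
      (fun x hx => (h2 x hx).continuousAt.continuousWithinAt) (fun x hx => by
        have hx' : 0 ≤ x ^ (-α - 1 - 1) := Real.rpow_nonneg (hpos x hx).le _
        have h6 : 0 ≤ c * (-α * ((α + 1) * x ^ (-α - 1 - 1))) :=
          mul_nonneg hc (mul_nonneg (by linarith) (mul_nonneg (by linarith) hx'))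
        have h7 : T * l ≤ T * (6 * x) :=
          mul_le_mul_of_nonneg_left (by linarith [hx.1, hpos x hx]) hT.le
        linarith) hl
    rw [h4] at this
    linarith
  · have := norm_integral_cexp_le_third hab hT h0 h1 h2 (fun x hx => by
        have hx' : 0 ≤ x ^ (-α - 1 - 1 - 1) := Real.rpow_nonneg (hpos x hx).le _
        have h6 : 0 ≤ c * (α * ((α + 1) * ((α + 2) * x ^ (-α - 1 - 1 - 1)))) := by positivity
        linarith) hl
    rw [h4] at this
    linarith

theorem norm_integral_damped_phase_le {α T X c D l a b : ℝ} (hα1 : -1 ≤ α) (hT : 0 < T)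
    (hc : 0 ≤ c) (hD : 0 ≤ D) (hl : 0 < l) (hlT : T * l ^ 3 = 1) (hla : l ≤ a) (hab : a ≤ b) :
    ‖∫ x in a..b, ((Real.exp (-(D * x ^ (-α))) : ℝ) : ℂ) *
      Complex.exp (((T * x ^ 3 + X * x - c * x ^ (-α) : ℝ) : ℂ) * Complex.I)‖ ≤ 44 * l := by
  have hpos : ∀ x ∈ Set.Icc a b, 0 < x := fun x hx => hl.trans_le (hla.trans hx.1)
  have hp : ∀ (q : ℝ), ContinuousOn (fun x : ℝ => x ^ q) (Set.Icc a b) :=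
    fun q x hx => (Real.continuousAt_rpow_const _ _ (Or.inl (hpos x hx).ne')).continuousWithinAt
  have hd : ∀ x ∈ Set.Icc a b, HasDerivAt (fun x : ℝ => Real.exp (-(D * x ^ (-α))))
      (α * (Real.exp (-(D * x ^ (-α))) * (D * x ^ (-α - 1)))) x := fun x hx => by
    have := (((Real.hasDerivAt_rpow_const (p := -α) (Or.inl (hpos x hx).ne')).const_mul D).fun_neg).exp
    exact this.congr_deriv (by ring)
  have h01 : ∀ x ∈ Set.Icc a b,
      0 ≤ Real.exp (-(D * x ^ (-α))) ∧ Real.exp (-(D * x ^ (-α))) ≤ 1 := fun x hx => by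
    refine ⟨(Real.exp_pos _).le, Real.exp_le_one_iff.2 ?_⟩
    have := mul_nonneg hD (Real.rpow_nonneg (hpos x hx).le (-α))
    linarith
  have hcE := hp (-α)
  have hcE1 := hp (-α - 1)
  have hcd : ContinuousOn (fun x : ℝ => α * (Real.exp (-(D * x ^ (-α))) * (D * x ^ (-α - 1))))
      (Set.Icc a b) := by fun_prop
  have hcdi : IntervalIntegrable
      (fun x : ℝ => α * (Real.exp (-(D * x ^ (-α))) * (D * x ^ (-α - 1)))) volume a b := by
    apply ContinuousOn.intervalIntegrable; rwa [Set.uIcc_of_le hab]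
  have h_int := intervalIntegral.integral_eq_sub_of_hasDerivAt (fun x hx => hd x
    (by rwa [Set.uIcc_of_le hab] at hx)) hcdi
  have ha := h01 a ⟨le_rfl, hab⟩
  have hb := h01 b ⟨hab, le_rfl⟩
  have hV : ∫ x in a..b, ‖((α * (Real.exp (-(D * x ^ (-α))) * (D * x ^ (-α - 1))) : ℝ) : ℂ)‖ ≤ 1 := by
    have hnn : ∀ x ∈ Set.Icc a b, 0 ≤ Real.exp (-(D * x ^ (-α))) * (D * x ^ (-α - 1)) := fun x hx =>
      mul_nonneg (Real.exp_pos _).le (mul_nonneg hD (Real.rpow_nonneg (hpos x hx).le _))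
    rcases le_or_gt 0 α with hα | hα
    · rw [intervalIntegral.integral_congr (g := fun x => 
        α * (Real.exp (-(D * x ^ (-α))) * (D * x ^ (-α - 1)))) (fun x hx => by
          rw [Set.uIcc_of_le hab] at hx
          simp only [Complex.norm_real, Real.norm_eq_abs]
          exact abs_of_nonneg (mul_nonneg hα (hnn x hx))), h_int]
      linarith
    · rw [intervalIntegral.integral_congr (g := fun x => 
        -(α * (Real.exp (-(D * x ^ (-α))) * (D * x ^ (-α - 1))))) (fun x hx => by
          rw [Set.uIcc_of_le hab] at hx
          simp only [Complex.norm_real, Real.norm_eq_abs]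
          exact abs_of_nonpos (mul_nonpos_of_nonpos_of_nonneg hα.le (hnn x hx))),
        intervalIntegral.integral_neg, h_int]
      linarith
  have hbn : ‖((Real.exp (-(D * b ^ (-α))) : ℝ) : ℂ)‖ ≤ 1 := by
    rw [Complex.norm_real, Real.norm_of_nonneg hb.1]; exact hb.2
  have := norm_integral_amplitude_le hab (M := 22 * l) (V := 1)
    (A := fun x => ((Real.exp (-(D * x ^ (-α))) : ℝ) : ℂ))
    (A' := fun x => ((α * (Real.exp (-(D * x ^ (-α))) * (D * x ^ (-α - 1))) : ℝ) : ℂ))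
    (F := fun x => Complex.exp (((T * x ^ 3 + X * x - c * x ^ (-α) : ℝ) : ℂ) * Complex.I))
    (fun x hx => (hd x hx).ofReal_comp) (by fun_prop) (by fun_prop)
    (fun x hx => norm_integral_cexp_phase_le hα1 hT hc hl hlT hla hx.1) hV
  refine this.trans ?_
  nlinarith

theorem norm_integral_power_phase_le_of_pos {ε α T X c D τ l a b : ℝ} (hε : 0 < ε) (hε1 : ε < 1)
    (hα1 : -1 ≤ α) (hT : 0 < T) (hc : 0 ≤ c) (hD : 0 ≤ D) (hl : 0 < l) (hlT : T * l ^ 3 = 1)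
    (ha : 0 < a) (hab : a ≤ b) :
    ‖∫ x in a..b, (x : ℂ) ^ (-(ε : ℂ) + τ * Complex.I) * (((Real.exp (-(D * x ^ (-α))) : ℝ) : ℂ) *
      Complex.exp (((T * x ^ 3 + X * x - c * x ^ (-α) : ℝ) : ℂ) * Complex.I))‖ ≤
      (1 / (1 - ε) + 88 + 44 / ε) * (1 + |τ|) * l ^ (1 - ε) := by
  set w : ℂ := -(ε : ℂ) + τ * Complex.I with hw
  have hwre : w.re = -ε := by simp [hw]
  have hwn : ‖w‖ ≤ ε + |τ| := by
    refine (norm_add_le _ _).trans ?_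
    rw [norm_neg, norm_mul, Complex.norm_real, Complex.norm_real, Complex.norm_I, mul_one,
      Real.norm_of_nonneg hε.le, Real.norm_eq_abs]
  set F : ℝ → ℂ := fun x => ((Real.exp (-(D * x ^ (-α))) : ℝ) : ℂ) *
      Complex.exp (((T * x ^ 3 + X * x - c * x ^ (-α) : ℝ) : ℂ) * Complex.I) with hF
  have hnF : ∀ x, 0 < x → ‖F x‖ ≤ 1 := fun x hx => by
    rw [hF]; simp only
    rw [norm_mul, Complex.norm_exp_ofReal_mul_I, Complex.norm_real, mul_one,
      Real.norm_of_nonneg (Real.exp_pos _).le]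
    apply Real.exp_le_one_iff.2
    have := mul_nonneg hD (Real.rpow_nonneg hx.le (-α))
    linarith
  have hnw : ∀ x : ℝ, 0 < x → ‖(x : ℂ) ^ w‖ = x ^ (-ε) := fun x hx => by
    rw [Complex.norm_cpow_eq_rpow_re_of_pos hx, hwre]
  have hp : ∀ (q : ℝ), ContinuousOn (fun x : ℝ => x ^ q) (Set.Ioi 0) :=
    fun q x hx => (Real.continuousAt_rpow_const _ _ (Or.inl (ne_of_gt hx))).continuousWithinAt
  have hcF : ContinuousOn F (Set.Ioi 0) := by
    have := hp (-α); fun_prop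
  have hcp : ∀ v : ℂ, ContinuousOn (fun x : ℝ => (x : ℂ) ^ v) (Set.Ioi 0) := fun v x hx =>
    (Complex.continuousAt_ofReal_cpow_const _ _ (Or.inr (ne_of_gt hx))).continuousWithinAt
  have hcW : ContinuousOn (fun x : ℝ => (x : ℂ) ^ w * F x) (Set.Ioi 0) := (hcp w).mul hcF
  have hsub : ∀ {x y : ℝ}, 0 < x → Set.Icc x y ⊆ Set.Ioi 0 := fun h z hz => h.trans_le hz.1
  have hlε : 0 < l ^ (1 - ε) := Real.rpow_pos_of_pos hl _
  have hll : l * l ^ (-ε) = l ^ (1 - ε) := by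
    rw [sub_eq_add_neg, Real.rpow_add hl, Real.rpow_one]
  have low : ∀ x y, 0 < x → x ≤ y → y ≤ l →
      ‖∫ x in x..y, (x : ℂ) ^ w * F x‖ ≤ 1 / (1 - ε) * l ^ (1 - ε) := by
    intro x y hx hxy hyl
    have hi : IntervalIntegrable (fun x : ℝ => x ^ (-ε)) volume x y := by
      apply ContinuousOn.intervalIntegrable; rw [Set.uIcc_of_le hxy]; exact (hp _).mono (hsub hx)
    calc _ ≤ ∫ x in x..y, x ^ (-ε) := by
          apply intervalIntegral.norm_integral_le_of_norm_le hxy _ hi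
          filter_upwards with z hz
          have hz0 := hx.trans hz.1
          rw [norm_mul, hnw z hz0]
          exact mul_le_of_le_one_right (Real.rpow_nonneg hz0.le _) (hnF z hz0)
      _ = (y ^ (-ε + 1) - x ^ (-ε + 1)) / (-ε + 1) := by
          rw [integral_rpow (Or.inl (by linarith))]
      _ ≤ l ^ (1 - ε) / (1 - ε) := by
          rw [neg_add_eq_sub]
          apply div_le_div_of_nonneg_right _ (by linarith)
          have e1 := Real.rpow_le_rpow (hx.le.trans hxy) hyl (by linarith : 0 ≤ 1 - ε)
          have e2 := Real.rpow_nonneg hx.le (1 - ε)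
          linarith
      _ = _ := by ring
  have high : ∀ x y, l ≤ x → x ≤ y →
      ‖∫ x in x..y, (x : ℂ) ^ w * F x‖ ≤ 44 * (2 + |τ| / ε) * l ^ (1 - ε) := by
    intro x y hlx hxy
    have hx0 := hl.trans_le hlx
    have hV : ∫ z in x..y, ‖w * (z : ℂ) ^ (w - 1)‖ ≤ (1 + |τ| / ε) * l ^ (-ε) := by
      have : ∫ z in x..y, ‖w * (z : ℂ) ^ (w - 1)‖ = ∫ z in x..y, ‖w‖ * z ^ (-ε - 1) := by
        apply intervalIntegral.integral_congr
        intro z hz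
        rw [Set.uIcc_of_le hxy] at hz
        simp only
        rw [norm_mul, Complex.norm_cpow_eq_rpow_re_of_pos (hx0.trans_le hz.1), Complex.sub_re, hwre,
          Complex.one_re]
      rw [this, intervalIntegral.integral_const_mul, integral_rpow (Or.inr ⟨by linarith, by
        rw [Set.uIcc_of_le hxy]; exact fun h => absurd h.1 (not_le.2 hx0)⟩), sub_add_cancel]
      have e1 : x ^ (-ε) ≤ l ^ (-ε) := Real.rpow_le_rpow_of_nonpos hl hlx (by linarith)
      have e2 : 0 ≤ y ^ (-ε) := Real.rpow_nonneg (hx0.le.trans hxy) _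
      have e3 : (y ^ (-ε) - x ^ (-ε)) / -ε ≤ l ^ (-ε) / ε := by
        rw [div_neg, ← neg_div]
        exact div_le_div_of_nonneg_right (by linarith) hε.le
      calc _ ≤ ‖w‖ * (l ^ (-ε) / ε) := mul_le_mul_of_nonneg_left e3 (norm_nonneg _)
        _ ≤ (ε + |τ|) * (l ^ (-ε) / ε) := mul_le_mul_of_nonneg_right hwn (by positivity)
        _ = _ := by field_simp
    have hbn : ‖((y : ℝ) : ℂ) ^ w‖ ≤ l ^ (-ε) := by
      rw [hnw y (hx0.trans_le hxy)]
      exact Real.rpow_le_rpow_of_nonpos hl (hlx.trans hxy) (by linarith)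
    have hw0 : w ≠ 0 := fun h => by rw [h, Complex.zero_re] at hwre; linarith
    have := norm_integral_amplitude_le hxy (M := 44 * l) (V := (1 + |τ| / ε) * l ^ (-ε))
      (A := fun x : ℝ => (x : ℂ) ^ w) (A' := fun x : ℝ => w * (x : ℂ) ^ (w - 1)) (F := F)
      (fun z hz => hasDerivAt_ofReal_cpow_const (hx0.trans_le hz.1).ne' hw0)
      (((hcp _).mono (hsub hx0)).const_smul w) (hcF.mono (hsub hx0))
      (fun z hz => norm_integral_damped_phase_le hα1 hT hc hD hl hlT hlx hz.1) hV
    refine this.trans ?_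
    rw [← hll]
    have : 44 * l * (‖((y : ℝ) : ℂ) ^ w‖ + (1 + |τ| / ε) * l ^ (-ε)) ≤
      44 * l * (l ^ (-ε) + (1 + |τ| / ε) * l ^ (-ε)) := by gcongr
    refine this.trans (le_of_eq (by ring))
  have hone : 0 < 1 / (1 - ε) := by apply one_div_pos.2; linarith
  have htot : 1 / (1 - ε) * l ^ (1 - ε) + 44 * (2 + |τ| / ε) * l ^ (1 - ε) ≤
      (1 / (1 - ε) + 88 + 44 / ε) * (1 + |τ|) * l ^ (1 - ε) := by
    rw [← add_mul]
    apply mul_le_mul_of_nonneg_right _ hlε.le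
    have h1 : 0 ≤ (1 / (1 - ε)) * |τ| := by positivity
    have h2 : 0 ≤ 44 / ε := by positivity
    have h3 := abs_nonneg τ
    have h4 : 44 * (2 + |τ| / ε) = 88 + 44 / ε * |τ| := by ring
    rw [h4]; nlinarith
  have hlow0 : 0 ≤ 1 / (1 - ε) * l ^ (1 - ε) := by positivity
  have hhigh0 : 0 ≤ 44 * (2 + |τ| / ε) * l ^ (1 - ε) := by positivity
  rcases le_or_gt b l with hbl | hbl
  · linarith [low a b ha hab hbl]
  rcases le_or_gt l a with hal | hal
  · linarith [high a b hal hab]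
  · exact (norm_integral_split_le hal.le hbl.le (hcW.mono (hsub ha)) (low a l ha hal.le le_rfl)
      (high l b le_rfl hbl.le)).trans htot

/-- The one-dimensional dispersive estimate. -/
theorem norm_integral_power_phase_le {ε α T X c D τ a b : ℝ} (hε : 0 < ε) (hε1 : ε < 1)
    (hα1 : -1 ≤ α) (hT : T ≠ 0) (hc : 0 ≤ T * c) (hD : 0 ≤ D) (ha : 0 < a) (hab : a ≤ b) :
    ‖∫ x in a..b, (x : ℂ) ^ (-(ε : ℂ) + τ * Complex.I) * (((Real.exp (-(D * x ^ (-α))) : ℝ) : ℂ) *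
      Complex.exp (((T * x ^ 3 + X * x - c * x ^ (-α) : ℝ) : ℂ) * Complex.I))‖ ≤
      (1 / (1 - ε) + 88 + 44 / ε) * (1 + |τ|) * |T| ^ (-(1 - ε) / 3) := by
  have hT' : 0 < |T| := abs_pos.2 hT
  have hl : 0 < |T| ^ (-(1 / 3 : ℝ)) := Real.rpow_pos_of_pos hT' _
  have hlT : |T| * (|T| ^ (-(1 / 3 : ℝ))) ^ 3 = 1 := by
    rw [← Real.rpow_natCast, ← Real.rpow_mul hT'.le]
    norm_num
    rw [Real.rpow_neg_one, mul_inv_cancel₀ hT'.ne']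
  have hll : (|T| ^ (-(1 / 3 : ℝ))) ^ (1 - ε) = |T| ^ (-(1 - ε) / 3) := by
    rw [← Real.rpow_mul hT'.le]; congr 1; ring
  rw [← hll]
  rcases lt_or_gt_of_ne hT with h | h
  · have := norm_integral_power_phase_le_of_pos (X := -X) (c := -c) (τ := -τ) hε hε1 hα1 hT'
      (by nlinarith) hD hl hlT ha hab
    rw [abs_neg] at this
    refine le_of_eq_of_le ?_ this
    rw [← Complex.norm_conj, ← intervalIntegral.intervalIntegral_conj]
    congr 1
    apply intervalIntegral.integral_congr
    intro x hx
    rw [Set.uIcc_of_le hab] at hx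
    have hx0 : 0 < x := ha.trans_le hx.1
    simp only [map_mul]
    congr 1
    · have hx1 : (x : ℂ) ≠ 0 := by exact_mod_cast hx0.ne'
      rw [Complex.cpow_def_of_ne_zero hx1, Complex.cpow_def_of_ne_zero hx1, ← Complex.exp_conj,
        ← Complex.ofReal_log hx0.le]
      simp
    · rw [Complex.conj_ofReal, ← Complex.exp_conj, abs_of_neg h]
      simp
      congr 1
      ring
  · rw [abs_of_pos h] at *
    exact norm_integral_power_phase_le_of_pos hε hε1 hα1 h (nonneg_of_mul_nonneg_right hc h)
      hD hl hlT ha hab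

theorem norm_cexp_ofReal_mul_I_mul (r : ℝ) (z : ℂ) : ‖Complex.exp ((r : ℂ) * Complex.I) * z‖ = ‖z‖ := by
  rw [norm_mul, Complex.norm_exp_ofReal_mul_I, one_mul]

theorem IFT2_eq_FT2_neg (f : ℝ × ℝ → ℂ) (p : ℝ × ℝ) : IFT2 f p = FT2 f (-p) := by
  unfold IFT2 FT2
  congr 1
  funext q
  congr 3
  simp only [Prod.fst_neg, Prod.snd_neg]
  push_cast
  ring

theorem continuous_phase (x : ℝ × ℝ) : Continuous fun p : ℝ × ℝ =>
    Complex.exp (((2 * Real.pi * (x.1 * p.1 + x.2 * p.2) : ℝ) : ℂ) * Complex.I) := by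
  fun_prop

theorem integrable_phase_mul_iff {f : ℝ × ℝ → ℂ} (x : ℝ × ℝ) :
    Integrable (fun p : ℝ × ℝ =>
      Complex.exp (((2 * Real.pi * (x.1 * p.1 + x.2 * p.2) : ℝ) : ℂ) * Complex.I) * f p) ↔
    Integrable f := by
  constructor
  · intro h
    refine (h.bdd_mul (c := 1) (continuous_phase (-x)).aestronglyMeasurable
      (Eventually.of_forall fun p => (Complex.norm_exp_ofReal_mul_I _).le)).congr
      (Eventually.of_forall fun p => ?_)
    simp only
    rw [← mul_assoc, ← Complex.exp_add]
    simp only [Prod.fst_neg, Prod.snd_neg]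
    rw [← add_mul, ← Complex.ofReal_add]
    ring_nf
    simp
  · intro h
    exact h.bdd_mul (c := 1) (continuous_phase x).aestronglyMeasurable
      (Eventually.of_forall fun p => (Complex.norm_exp_ofReal_mul_I _).le)

theorem norm_IFT2_le (f : ℝ × ℝ → ℂ) (p : ℝ × ℝ) : ‖IFT2 f p‖ ≤ ∫ x, ‖f x‖ := by
  refine (norm_integral_le_integral_norm _).trans (le_of_eq ?_)
  simp_rw [norm_cexp_ofReal_mul_I_mul]

theorem norm_FT2_le (f : ℝ × ℝ → ℂ) (p : ℝ × ℝ) : ‖FT2 f p‖ ≤ ∫ x, ‖f x‖ := by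
  have := norm_IFT2_le f (-p)
  rwa [IFT2_eq_FT2_neg, neg_neg] at this

theorem IFT2_eq_zero_of_not_integrable {f : ℝ × ℝ → ℂ} (hf : ¬ Integrable f) : IFT2 f = 0 := by
  funext p
  exact integral_undef (fun h => hf ((integrable_phase_mul_iff p).1 h))

theorem FT2_eq_zero_of_not_integrable {f : ℝ × ℝ → ℂ} (hf : ¬ Integrable f) : FT2 f = 0 := by
  funext p
  have := congrFun (IFT2_eq_zero_of_not_integrable hf) (-p)
  rwa [IFT2_eq_FT2_neg, neg_neg] at this

theorem continuous_IFT2 {f : ℝ × ℝ → ℂ} (hf : Integrable f) : Continuous (IFT2 f) := by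
  refine continuous_of_dominated (bound := fun p => ‖f p‖) (fun x =>
    ((integrable_phase_mul_iff x).2 hf).aestronglyMeasurable) (fun x =>
    Eventually.of_forall fun p => (norm_cexp_ofReal_mul_I_mul _ _).le) hf.norm
    (Eventually.of_forall fun p => by fun_prop)

theorem continuous_FT2 {f : ℝ × ℝ → ℂ} (hf : Integrable f) : Continuous (FT2 f) := by
  have h : FT2 f = fun p => IFT2 f (-p) := by funext p; rw [IFT2_eq_FT2_neg, neg_neg]
  rw [h]
  exact (continuous_IFT2 hf).comp continuous_neg

/-- Self-adjointness of the inverse Fourier transform for the bilinear pairing. -/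
theorem integral_IFT2_mul {f g : ℝ × ℝ → ℂ} (hf : Integrable f) (hg : Integrable g) :
    ∫ x, IFT2 f x * g x = ∫ p, f p * IFT2 g p := by
  have h_int : Integrable (Function.uncurry fun x p : ℝ × ℝ =>
      Complex.exp (((2 * Real.pi * (x.1 * p.1 + x.2 * p.2) : ℝ) : ℂ) * Complex.I) * (g x * f p))
      (volume.prod volume) := by
    refine (hg.mul_prod hf).bdd_mul (c := 1) ?_
      (Eventually.of_forall fun p => (Complex.norm_exp_ofReal_mul_I _).le)
    exact Continuous.aestronglyMeasurable (by fun_prop)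
  have := integral_integral_swap h_int
  unfold IFT2
  calc _ = ∫ x : ℝ × ℝ, ∫ p : ℝ × ℝ,
        Complex.exp (((2 * Real.pi * (x.1 * p.1 + x.2 * p.2) : ℝ) : ℂ) * Complex.I) * (g x * f p) := by
        congr 1; funext x
        rw [← integral_mul_const]
        congr 1; funext p; ring
    _ = _ := this
    _ = _ := by
        congr 1; funext p
        rw [← integral_const_mul]
        congr 1; funext x
        rw [show x.1 * p.1 + x.2 * p.2 = p.1 * x.1 + p.2 * x.2 by ring]
        ring

theorem IFT2_comp_neg (f : ℝ × ℝ → ℂ) (p : ℝ × ℝ) : IFT2 (fun q => f (-q)) p = FT2 f p := by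
  unfold IFT2 FT2
  rw [← integral_neg_eq_self]
  congr 1; funext q
  simp only [neg_neg, Prod.fst_neg, Prod.snd_neg]
  congr 3
  push_cast
  ring

theorem integral_FT2_mul {f g : ℝ × ℝ → ℂ} (hf : Integrable f) (hg : Integrable g) :
    ∫ x, FT2 f x * g x = ∫ p, f p * FT2 g p := by
  have h := integral_IFT2_mul hf hg.comp_neg
  rw [← integral_neg_eq_self] at h
  simp_rw [IFT2_comp_neg, IFT2_eq_FT2_neg, neg_neg] at h
  exact h

/-- A Fourier multiplier with integrable symbol is a convolution operator. -/
theorem IFT2_mul_FT2 {M f : ℝ × ℝ → ℂ} (hM : Integrable M) (hf : Integrable f) (x : ℝ × ℝ) :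
    IFT2 (fun p => M p * FT2 f p) x = ∫ q, IFT2 M (x - q) * f q := by
  have h1 : ∀ q, IFT2 M (x - q) = FT2 (fun p => Complex.exp (((2 * Real.pi *
      (x.1 * p.1 + x.2 * p.2) : ℝ) : ℂ) * Complex.I) * M p) q := by
    intro q
    unfold IFT2 FT2
    congr 1; funext p
    rw [← mul_assoc, ← Complex.exp_add]
    congr 2
    push_cast
    simp only [Prod.fst_sub, Prod.snd_sub]
    push_cast
    ring
  simp_rw [h1]
  rw [integral_FT2_mul ((integrable_phase_mul_iff x).2 hM) hf]
  unfold IFT2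
  simp_rw [mul_assoc]

theorem norm_IFT2_mul_FT2_le {M f : ℝ × ℝ → ℂ} {K : ℝ} (hM : Integrable M) (hf : Integrable f)
    (hK : ∀ w, ‖IFT2 M w‖ ≤ K) (x : ℝ × ℝ) :
    ‖IFT2 (fun p => M p * FT2 f p) x‖ ≤ K * ∫ q, ‖f q‖ := by
  rw [IFT2_mul_FT2 hM hf, ← integral_const_mul]
  refine norm_integral_le_of_norm_le (hf.norm.const_mul K) (Eventually.of_forall fun q => ?_)
  rw [norm_mul]
  exact mul_le_mul_of_nonneg_right (hK _) (norm_nonneg _)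

theorem FT2_ofLp (f : ℝ × ℝ → ℂ) (w : WithLp 2 (ℝ × ℝ)) :
    FourierTransform.fourier (fun v : WithLp 2 (ℝ × ℝ) => f (WithLp.ofLp v)) w = FT2 f (WithLp.ofLp w) := by
  rw [Real.fourier_eq']
  unfold FT2
  rw [← (WithLp.volume_preserving_ofLp ℝ ℝ).integral_comp
    (WithLp.homeomorphProd 2 ℝ ℝ).measurableEmbedding]
  congr 1; funext v
  rw [smul_eq_mul]
  congr 3
  simp [WithLp.prod_inner_apply]

theorem FT2_IFT2_of_continuousAt {f : ℝ × ℝ → ℂ} (hf : Integrable f) (hf' : Integrable (IFT2 f))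
    {p : ℝ × ℝ} (hp : ContinuousAt f p) : FT2 (IFT2 f) p = f p := by
  have hmp := WithLp.volume_preserving_ofLp ℝ ℝ
  have hemb := (WithLp.homeomorphProd 2 ℝ ℝ).measurableEmbedding
  have h1 : FourierTransformInv.fourierInv (fun v : WithLp 2 (ℝ × ℝ) => f (WithLp.ofLp v)) =
      fun w => IFT2 f (WithLp.ofLp w) := by
    funext w
    rw [Real.fourierInv_eq_fourier_neg, FT2_ofLp, IFT2_eq_FT2_neg]
    rfl
  have hi : Integrable (fun v : WithLp 2 (ℝ × ℝ) => f (WithLp.ofLp v)) :=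
    (hmp.integrable_comp_emb hemb).2 hf
  have hi' : Integrable (fun v : WithLp 2 (ℝ × ℝ) => IFT2 f (WithLp.ofLp v)) :=
    (hmp.integrable_comp_emb hemb).2 hf'
  have h2 := hi.fourier_fourierInv_eq (v := WithLp.toLp 2 p) (hi'.comp_neg.congr
      (Eventually.of_forall fun w => by simp only [FT2_ofLp, IFT2_eq_FT2_neg, WithLp.ofLp_neg, neg_neg]))
    (ContinuousAt.comp (f := fun v : WithLp 2 (ℝ × ℝ) => WithLp.ofLp v) (g := f) hp
      (WithLp.prod_continuous_ofLp 2 ℝ ℝ).continuousAt)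
  rw [h1, FT2_ofLp] at h2
  exact h2

theorem IFT2_mul_prod (a b : ℝ → ℂ) (w : ℝ × ℝ) :
    IFT2 (fun p => a p.1 * b p.2) w =
      (∫ x, Complex.exp (((2 * Real.pi * (w.1 * x) : ℝ) : ℂ) * Complex.I) * a x) *
      ∫ y, Complex.exp (((2 * Real.pi * (w.2 * y) : ℝ) : ℂ) * Complex.I) * b y := by
  rw [← integral_prod_mul]
  unfold IFT2
  refine integral_congr_ae (Eventually.of_forall fun p => ?_)
  simp only
  rw [show (2 * Real.pi * (w.1 * p.1 + w.2 * p.2) : ℝ) =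
    2 * Real.pi * (w.1 * p.1) + 2 * Real.pi * (w.2 * p.2) by ring, Complex.ofReal_add, add_mul,
    Complex.exp_add]
  ring

theorem integral_phase_mul_gaussian {b : ℂ} (hb : 0 < b.re) (y : ℝ) :
    ∫ x : ℝ, Complex.exp (((2 * Real.pi * (y * x) : ℝ) : ℂ) * Complex.I) *
      Complex.exp (-b * (x : ℂ) ^ 2) =
    (Real.pi / b) ^ (1 / 2 : ℂ) * Complex.exp (-(Real.pi ^ 2 * y ^ 2 : ℝ) / b) := by
  have h := fourierIntegral_gaussian hb (2 * Real.pi * y : ℝ)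
  have hb0 : b ≠ 0 := by rintro rfl; simp at hb
  have e : (-((2 * Real.pi * y : ℝ) : ℂ) ^ 2 / (4 * b)) = -(Real.pi ^ 2 * y ^ 2 : ℝ) / b := by
    field_simp
    push_cast
    ring
  rw [e] at h
  rw [← h]
  congr 1; funext x
  congr 2
  push_cast
  ring

theorem IFT2_gaussian {δ : ℝ} (hδ : 0 < δ) (w : ℝ × ℝ) :
    IFT2 (fun p => ((Real.exp (-(Real.pi * δ) * p.1 ^ 2) * Real.exp (-(Real.pi * δ) * p.2 ^ 2) : ℝ) : ℂ)) w =
      ((δ⁻¹ * (Real.exp (-(Real.pi / δ) * w.1 ^ 2) * Real.exp (-(Real.pi / δ) * w.2 ^ 2)) : ℝ) : ℂ) := by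
  have hpi := Real.pi_pos
  have key : ∀ y : ℝ, ∫ x : ℝ, Complex.exp (((2 * Real.pi * (y * x) : ℝ) : ℂ) * Complex.I) *
      ((Real.exp (-(Real.pi * δ) * x ^ 2) : ℝ) : ℂ) =
      ((√(δ⁻¹) * Real.exp (-(Real.pi / δ) * y ^ 2) : ℝ) : ℂ) := by
    intro y
    have h := integral_phase_mul_gaussian (b := ((Real.pi * δ : ℝ) : ℂ)) (by
      rw [Complex.ofReal_re]; positivity) y
    have e1 : ((Real.pi : ℂ) / ((Real.pi * δ : ℝ) : ℂ)) ^ (1 / 2 : ℂ) = ((√(δ⁻¹) : ℝ) : ℂ) := by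
      rw [Real.sqrt_eq_rpow, Complex.ofReal_cpow (by positivity), ← Complex.ofReal_div]
      congr 2
      · field_simp
      · norm_num
    have e2 : (-((Real.pi ^ 2 * y ^ 2 : ℝ) : ℂ) / ((Real.pi * δ : ℝ) : ℂ)) =
        ((-(Real.pi / δ) * y ^ 2 : ℝ) : ℂ) := by
      rw [← Complex.ofReal_neg, ← Complex.ofReal_div]
      congr 1
      field_simp
    rw [e1, e2] at h
    rw [Complex.ofReal_mul, Complex.ofReal_exp, ← h]
    congr 1; funext x
    rw [Complex.ofReal_exp]
    push_cast
    rfl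
  have h := IFT2_mul_prod (fun x => ((Real.exp (-(Real.pi * δ) * x ^ 2) : ℝ) : ℂ))
    (fun x => ((Real.exp (-(Real.pi * δ) * x ^ 2) : ℝ) : ℂ)) w
  rw [key, key, ← Complex.ofReal_mul] at h
  simp_rw [Complex.ofReal_mul _ (Real.exp _)] at h ⊢
  rw [h]
  congr 1
  rw [show √δ⁻¹ * Real.exp (-(Real.pi / δ) * w.1 ^ 2) * (√δ⁻¹ * Real.exp (-(Real.pi / δ) * w.2 ^ 2)) =
    (√δ⁻¹ * √δ⁻¹) * (Real.exp (-(Real.pi / δ) * w.1 ^ 2) * Real.exp (-(Real.pi / δ) * w.2 ^ 2)) by ring,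
    Real.mul_self_sqrt (by positivity)]

theorem integrable_gaussian_prod {b : ℝ} (hb : 0 < b) :
    Integrable (fun p : ℝ × ℝ => Real.exp (-b * p.1 ^ 2) * Real.exp (-b * p.2 ^ 2)) :=
  (integrable_exp_neg_mul_sq hb).mul_prod (integrable_exp_neg_mul_sq hb)

theorem integral_gaussian_kernel {δ : ℝ} (hδ : 0 < δ) :
    ∫ w : ℝ × ℝ, δ⁻¹ * (Real.exp (-(Real.pi / δ) * w.1 ^ 2) * Real.exp (-(Real.pi / δ) * w.2 ^ 2)) = 1 := by
  have hpi := Real.pi_pos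
  rw [integral_const_mul]
  have := integral_prod_mul (μ := (volume : Measure ℝ)) (ν := (volume : Measure ℝ))
    (fun x : ℝ => Real.exp (-(Real.pi / δ) * x ^ 2)) (fun x : ℝ => Real.exp (-(Real.pi / δ) * x ^ 2))
  rw [integral_gaussian, Real.mul_self_sqrt (by positivity)] at this
  rw [show (volume : Measure (ℝ × ℝ)) = volume.prod volume from rfl, this]
  field_simp

theorem conj_FT2 (f : ℝ × ℝ → ℂ) (p : ℝ × ℝ) :
    starRingEnd ℂ (FT2 f p) = IFT2 (fun q => starRingEnd ℂ (f q)) p := by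
  unfold FT2 IFT2
  rw [← integral_conj]
  congr 1; funext q
  rw [map_mul, ← Complex.exp_conj, map_mul, map_neg, Complex.conj_ofReal, Complex.conj_I]
  ring_nf

/-- A symmetric Schur-type bound for convolution against a nonnegative kernel. -/
theorem lintegral_conv_mul_le {k F : ℝ × ℝ → ℝ≥0∞} (hk : Measurable k) (hF : AEMeasurable F)
    (hF' : ∀ x, F x ≠ ∞) :
    ∫⁻ x, ∫⁻ q, k (x - q) * F q * F x ≤ (∫⁻ x, k x) * ∫⁻ x, F x ^ 2 := by
  have hpt : ∀ x q, k (x - q) * F q * F x ≤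
      k (x - q) * F q ^ 2 / 2 + k (x - q) * F x ^ 2 / 2 := by
    intro x q
    have h2 : F q * F x ≤ (F q ^ 2 + F x ^ 2) / 2 := by
      rw [ENNReal.le_div_iff_mul_le (by simp) (by simp)]
      lift F q to NNReal using hF' q with a
      lift F x to NNReal using hF' x with b
      norm_cast
      have := two_mul_le_add_sq a b
      nlinarith
    calc k (x - q) * F q * F x = k (x - q) * (F q * F x) := by ring
      _ ≤ k (x - q) * ((F q ^ 2 + F x ^ 2) / 2) := by gcongr
      _ = _ := by rw [ENNReal.div_add_div_same, ← mul_add, mul_div_assoc]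
  have hm1 : AEMeasurable (fun z : (ℝ × ℝ) × (ℝ × ℝ) => k (z.1 - z.2) * F z.2 ^ 2 / 2)
      (volume.prod volume) :=
    (((hk.comp (measurable_fst.sub measurable_snd)).aemeasurable.mul
      ((hF.comp_quasiMeasurePreserving Measure.quasiMeasurePreserving_snd).pow_const 2))).div_const 2
  calc _ ≤ ∫⁻ x, ∫⁻ q, (k (x - q) * F q ^ 2 / 2 + k (x - q) * F x ^ 2 / 2) :=
        lintegral_mono fun x => lintegral_mono fun q => hpt x q
    _ = ∫⁻ x, ((∫⁻ q, k (x - q) * F q ^ 2 / 2) + ∫⁻ q, k (x - q) * F x ^ 2 / 2) := by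
        congr 1; funext x
        refine lintegral_add_right _ ?_
        exact ((hk.comp (measurable_const.sub measurable_id)).mul_const _).div_const _
    _ = (∫⁻ x, ∫⁻ q, k (x - q) * F q ^ 2 / 2) + ∫⁻ x, ∫⁻ q, k (x - q) * F x ^ 2 / 2 :=
        lintegral_add_left' hm1.lintegral_prod_right' _
    _ = (∫⁻ x, k x) * (∫⁻ x, F x ^ 2) / 2 + (∫⁻ x, k x) * (∫⁻ x, F x ^ 2) / 2 := by
        congr 1
        · rw [lintegral_lintegral_swap hm1]
          simp_rw [div_eq_mul_inv, mul_assoc]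
          have : ∀ q, ∫⁻ x, k (x - q) * (F q ^ 2 * 2⁻¹) = (∫⁻ x, k x) * (F q ^ 2 * 2⁻¹) := by
            intro q
            rw [lintegral_mul_const (f := fun x => k (x - q)) _ (by fun_prop),
              lintegral_sub_right_eq_self (fun x => k x) q]
          simp_rw [this]
          rw [lintegral_const_mul'' _ ((hF.pow_const 2).mul_const _), lintegral_mul_const'' _ (hF.pow_const 2)]
        · simp_rw [div_eq_mul_inv, mul_assoc]
          have : ∀ x, ∫⁻ q, k (x - q) * (F x ^ 2 * 2⁻¹) = (∫⁻ x, k x) * (F x ^ 2 * 2⁻¹) := by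
            intro q
            rw [lintegral_mul_const (f := fun x => k (q - x)) _ (by fun_prop),
              lintegral_sub_left_eq_self (fun x => k x) q]
          simp_rw [this]
          rw [lintegral_const_mul'' _ ((hF.pow_const 2).mul_const _), lintegral_mul_const'' _ (hF.pow_const 2)]
    _ = _ := ENNReal.add_halves _

theorem lintegral_gaussian_mul_FT2_sq_le {f : ℝ × ℝ → ℂ} (hf : Integrable f) {δ : ℝ} (hδ : 0 < δ) :
    ∫⁻ p : ℝ × ℝ, ENNReal.ofReal (Real.exp (-(Real.pi * δ) * p.1 ^ 2) *
      Real.exp (-(Real.pi * δ) * p.2 ^ 2)) * ‖FT2 f p‖ₑ ^ 2 ≤ ∫⁻ x, ‖f x‖ₑ ^ 2 := by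
  have hpi := Real.pi_pos
  set G : ℝ × ℝ → ℝ := fun p => Real.exp (-(Real.pi * δ) * p.1 ^ 2) *
      Real.exp (-(Real.pi * δ) * p.2 ^ 2) with hG
  set K : ℝ × ℝ → ℝ := fun w => δ⁻¹ * (Real.exp (-(Real.pi / δ) * w.1 ^ 2) *
    Real.exp (-(Real.pi / δ) * w.2 ^ 2)) with hK
  have hG0 : ∀ p, 0 ≤ G p := fun p => by positivity
  have hK0 : ∀ p, 0 ≤ K p := fun p => by positivity
  have hGi : Integrable G := integrable_gaussian_prod (by positivity)
  have hKi : Integrable K := (integrable_gaussian_prod (by positivity)).const_mul _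
  have hGK : ∀ w, IFT2 (fun p => (G p : ℂ)) w = K w := IFT2_gaussian hδ
  have hFc := continuous_FT2 hf
  have hGf : Integrable (fun p => (G p : ℂ) * FT2 f p) :=
    hGi.ofReal.mul_bdd (c := ∫ x, ‖f x‖) hFc.aestronglyMeasurable
      (Eventually.of_forall fun p => norm_FT2_le f p)
  have hGff : Integrable (fun p => G p * ‖FT2 f p‖ ^ 2) := by
    refine hGi.mul_bdd (c := (∫ x, ‖f x‖) ^ 2) (hFc.norm.pow 2).aestronglyMeasurable
      (Eventually.of_forall fun p => ?_)
    rw [norm_pow, norm_norm]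
    exact pow_le_pow_left₀ (norm_nonneg _) (norm_FT2_le f p) 2
  have hfc : Integrable (fun q => starRingEnd ℂ (f q)) :=
    Complex.conjLIE.toContinuousLinearEquiv.toContinuousLinearMap.integrable_comp hf
  have h1 : ((∫ p, G p * ‖FT2 f p‖ ^ 2 : ℝ) : ℂ) =
      ∫ x, (∫ q, (K (x - q) : ℂ) * f q) * starRingEnd ℂ (f x) := by
    rw [← integral_complex_ofReal]
    have : ∀ x, ∫ q, (K (x - q) : ℂ) * f q = IFT2 (fun p => (G p : ℂ) * FT2 f p) x := by
      intro x
      rw [IFT2_mul_FT2 (M := fun p => (G p : ℂ)) hGi.ofReal hf]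
      simp_rw [hGK]
    simp_rw [this]
    rw [integral_IFT2_mul hGf hfc]
    congr 1; funext p
    rw [← conj_FT2, mul_assoc (G p : ℂ), Complex.mul_conj, Complex.normSq_eq_norm_sq]
    exact Complex.ofReal_mul _ _
  have h2 : ENNReal.ofReal (∫ p, G p * ‖FT2 f p‖ ^ 2) =
      ∫⁻ p, ENNReal.ofReal (G p) * ‖FT2 f p‖ₑ ^ 2 := by
    rw [ofReal_integral_eq_lintegral_ofReal hGff
      (Eventually.of_forall fun p => mul_nonneg (hG0 p) (by positivity))]
    congr 1; funext p
    rw [ENNReal.ofReal_mul (hG0 p), ENNReal.ofReal_pow (norm_nonneg _), ofReal_norm]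
  rw [← h2]
  have h3 : ENNReal.ofReal (∫ p, G p * ‖FT2 f p‖ ^ 2) =
      ‖((∫ p, G p * ‖FT2 f p‖ ^ 2 : ℝ) : ℂ)‖ₑ := by
    rw [← ofReal_norm, Complex.norm_real, Real.norm_of_nonneg]
    exact integral_nonneg fun p => mul_nonneg (hG0 p) (by positivity)
  rw [h3, h1]
  have h4 : ∫⁻ w, ENNReal.ofReal (K w) = 1 := by
    rw [← ofReal_integral_eq_lintegral_ofReal hKi (Eventually.of_forall hK0),
      integral_gaussian_kernel hδ, ENNReal.ofReal_one]
  calc _ ≤ ∫⁻ x, ‖(∫ q, (K (x - q) : ℂ) * f q) * starRingEnd ℂ (f x)‖ₑ :=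
        enorm_integral_le_lintegral_enorm _
    _ ≤ ∫⁻ x, ∫⁻ q, ENNReal.ofReal (K (x - q)) * ‖f q‖ₑ * ‖f x‖ₑ := by
        refine lintegral_mono fun x => ?_
        rw [enorm_mul, RCLike.enorm_conj, lintegral_mul_const' _ _ enorm_ne_top]
        gcongr
        refine (enorm_integral_le_lintegral_enorm _).trans (lintegral_mono fun q => ?_)
        rw [enorm_mul, ← ofReal_norm (K (x - q) : ℂ), Complex.norm_real,
          Real.norm_of_nonneg (hK0 _)]
    _ ≤ (∫⁻ w, ENNReal.ofReal (K w)) * ∫⁻ x, ‖f x‖ₑ ^ 2 := by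
        refine lintegral_conv_mul_le ?_ hf.aestronglyMeasurable.enorm (fun _ => enorm_ne_top)
        exact (Continuous.measurable (by fun_prop)).ennreal_ofReal
    _ = _ := by rw [h4, one_mul]

/-- Bessel's inequality for the Fourier transform of an integrable function. -/
theorem lintegral_FT2_sq_le {f : ℝ × ℝ → ℂ} (hf : Integrable f) :
    ∫⁻ p, ‖FT2 f p‖ₑ ^ 2 ≤ ∫⁻ x, ‖f x‖ₑ ^ 2 := by
  have hFc := continuous_FT2 hf
  have hlim : ∀ p : ℝ × ℝ, Tendsto (fun n : ℕ => ENNReal.ofReal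
      (Real.exp (-(Real.pi * (1 / ((n : ℝ) + 1))) * p.1 ^ 2) *
      Real.exp (-(Real.pi * (1 / ((n : ℝ) + 1))) * p.2 ^ 2)) * ‖FT2 f p‖ₑ ^ 2) atTop
      (nhds (‖FT2 f p‖ₑ ^ 2)) := by
    intro p
    have h0 := tendsto_one_div_add_atTop_nhds_zero_nat (𝕜 := ℝ)
    have hc : Continuous fun d : ℝ => Real.exp (-(Real.pi * d) * p.1 ^ 2) *
      Real.exp (-(Real.pi * d) * p.2 ^ 2) := by fun_prop
    have h1 := ENNReal.tendsto_ofReal ((hc.tendsto 0).comp h0)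
    have h2 := ENNReal.Tendsto.mul_const (b := ‖FT2 f p‖ₑ ^ 2) h1 (Or.inl (by simp))
    simpa using h2
  calc ∫⁻ p, ‖FT2 f p‖ₑ ^ 2 = ∫⁻ p, liminf (fun n : ℕ => ENNReal.ofReal
      (Real.exp (-(Real.pi * (1 / ((n : ℝ) + 1))) * p.1 ^ 2) *
      Real.exp (-(Real.pi * (1 / ((n : ℝ) + 1))) * p.2 ^ 2)) * ‖FT2 f p‖ₑ ^ 2) atTop := by
        congr 1; funext p
        exact (hlim p).liminf_eq.symm
    _ ≤ _ := by
        refine (lintegral_liminf_le fun n => ?_).trans ?_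
        · exact Continuous.measurable (by fun_prop) |>.ennreal_ofReal.mul (hFc.measurable.enorm.pow_const 2)
        · refine liminf_le_of_le (h := fun b hb => ?_)
          obtain ⟨n, hn⟩ := hb.exists
          exact hn.trans (lintegral_gaussian_mul_FT2_sq_le hf (by positivity))

/-- The symbol of `Wgrp α t`. -/
def groupSymbol (α t : ℝ) (p : ℝ × ℝ) : ℂ :=
  Complex.exp (-Complex.I * (t : ℂ) *
    ((p.1 ^ 3 + Real.sign p.1 * |p.1| ^ α * p.2 ^ 2 : ℝ) : ℂ))

theorem norm_groupSymbol (α t : ℝ) (p : ℝ × ℝ) : ‖groupSymbol α t p‖ = 1 := by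
  unfold groupSymbol
  rw [show ∀ r : ℝ, -Complex.I * (t : ℂ) * (r : ℂ) = ((-(t * r) : ℝ) : ℂ) * Complex.I from
    fun r => by push_cast; ring, Complex.norm_exp_ofReal_mul_I]

theorem measurable_realSign : Measurable Real.sign := by
  unfold Real.sign
  exact Measurable.ite measurableSet_Iio measurable_const
    (Measurable.ite measurableSet_Ioi measurable_const measurable_const)

theorem measurable_groupSymbol (α t : ℝ) : Measurable (groupSymbol α t) := by
  unfold groupSymbol
  have := measurable_realSign
  fun_prop

/-- The frequencies with `a ≤ |ξ| ≤ b`. -/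
def freqShell (a b : ℝ) : Set (ℝ × ℝ) := {p | a ≤ |p.1| ∧ |p.1| ≤ b}

theorem measurableSet_freqShell (a b : ℝ) : MeasurableSet (freqShell a b) := by
  have h : Measurable fun p : ℝ × ℝ => |p.1| := by fun_prop
  exact (measurableSet_le measurable_const h).inter (measurableSet_le h measurable_const)

/-- A truncated and damped version of the symbol of `Wgrp α t`. -/
def regSymbol (α t δ a b : ℝ) : ℝ × ℝ → ℂ :=
  (freqShell a b).indicator fun p =>
    ((Real.exp (-(δ * |p.1| ^ α * p.2 ^ 2)) : ℝ) : ℂ) * groupSymbol α t p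

theorem measurable_regSymbol (α t δ a b : ℝ) : Measurable (regSymbol α t δ a b) :=
  ((Measurable.complex_ofReal (by fun_prop)).mul (measurable_groupSymbol α t)).indicator
    (measurableSet_freqShell a b)

theorem norm_regSymbol_le_one {α t δ a b : ℝ} (hδ : 0 ≤ δ) (p : ℝ × ℝ) :
    ‖regSymbol α t δ a b p‖ ≤ 1 := by
  unfold regSymbol
  refine (norm_indicator_le_norm_self _ _).trans ?_
  rw [norm_mul, norm_groupSymbol, mul_one, Complex.norm_real, Real.norm_of_nonneg (Real.exp_pos _).le,
    Real.exp_le_one_iff]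
  have : 0 ≤ |p.1| ^ α := by positivity
  have : 0 ≤ δ * |p.1| ^ α * p.2 ^ 2 := by positivity
  linarith

theorem abs_log_le_of_mem {a b r : ℝ} (ha : 0 < a) (har : a ≤ r) (hrb : r ≤ b) :
    |Real.log r| ≤ |Real.log a| + |Real.log b| := by
  have hr := ha.trans_le har
  have h1 := Real.log_le_log ha har
  have h2 := Real.log_le_log hr hrb
  rw [abs_le]
  constructor
  · linarith [neg_abs_le (Real.log a), abs_nonneg (Real.log b)]
  · linarith [le_abs_self (Real.log b), abs_nonneg (Real.log a)]

theorem integrable_regSymbol {α t δ a b : ℝ} (hδ : 0 < δ) (ha : 0 < a) :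
    Integrable (regSymbol α t δ a b) := by
  set L := |Real.log a| + |Real.log b|
  set κ := Real.exp (-(|α| * L))
  have hκ : 0 < κ := Real.exp_pos _
  have h1 : Integrable ((Set.Icc (-b) b).indicator fun _ : ℝ => (1 : ℝ)) :=
    (integrable_indicator_iff measurableSet_Icc).2 (integrableOn_const (by simp) (by simp))
  have h2 := integrable_exp_neg_mul_sq (b := δ * κ) (by positivity)
  refine (h1.mul_prod h2).mono' (measurable_regSymbol α t δ a b).aestronglyMeasurable
    (Eventually.of_forall fun p => ?_)
  by_cases hp : p ∈ freqShell a b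
  · have hp0 : 0 < |p.1| := ha.trans_le hp.1
    have hp2 : p.1 ∈ Set.Icc (-b) b := abs_le.1 hp.2
    rw [regSymbol, Set.indicator_of_mem hp, Set.indicator_of_mem hp2, one_mul, norm_mul,
      norm_groupSymbol, mul_one, Complex.norm_real, Real.norm_of_nonneg (Real.exp_pos _).le,
      Real.exp_le_exp]
    have hle : κ ≤ |p.1| ^ α := by
      rw [Real.rpow_def_of_pos hp0]
      apply Real.exp_le_exp.2
      have h3 := abs_log_le_of_mem ha hp.1 hp.2
      have h4 : |Real.log (|p.1|) * α| ≤ |α| * L := by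
        rw [abs_mul, mul_comm]
        gcongr
      linarith [neg_abs_le (Real.log (|p.1|) * α)]
    have : δ * κ * p.2 ^ 2 ≤ δ * |p.1| ^ α * p.2 ^ 2 := by gcongr
    linarith
  · rw [regSymbol, Set.indicator_of_notMem hp, norm_zero]
    refine mul_nonneg (Set.indicator_nonneg (fun _ _ => zero_le_one) _) (Real.exp_pos _).le

/-- The analytic family of truncated symbols `|ξ|^{zσ} m(ξ, η)`. -/
def famSymbol (α t δ a b σ : ℝ) (z : ℂ) (p : ℝ × ℝ) : ℂ :=
  ((|p.1| : ℝ) : ℂ) ^ (z * σ) * regSymbol α t δ a b p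

theorem measurable_famSymbol (α t δ a b σ : ℝ) (z : ℂ) : Measurable (famSymbol α t δ a b σ z) :=
  (Measurable.pow_const (by fun_prop) _).mul (measurable_regSymbol α t δ a b)

theorem regSymbol_eq_zero {α t δ a b : ℝ} {p : ℝ × ℝ} (hp : p ∉ freqShell a b) :
    regSymbol α t δ a b p = 0 := Set.indicator_of_notMem hp _

theorem norm_famSymbol_le {α t δ a b σ : ℝ} (ha : 0 < a) {z : ℂ} {R : ℝ} (hz : |z.re| ≤ R) (p : ℝ × ℝ) :
    ‖famSymbol α t δ a b σ z p‖ ≤ Real.exp (R * |σ| * (|Real.log a| + |Real.log b|)) *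
      ‖regSymbol α t δ a b p‖ := by
  unfold famSymbol
  by_cases hp : p ∈ freqShell a b
  · have hp0 : 0 < |p.1| := ha.trans_le hp.1
    rw [norm_mul]
    gcongr
    rw [Complex.norm_cpow_eq_rpow_re_of_pos hp0, Real.rpow_def_of_pos hp0, Real.exp_le_exp]
    refine (le_abs_self _).trans ?_
    rw [Complex.re_mul_ofReal, abs_mul, abs_mul, mul_comm]
    have hR : 0 ≤ R := (abs_nonneg _).trans hz
    gcongr
    exact abs_log_le_of_mem ha hp.1 hp.2
  · rw [regSymbol_eq_zero hp]
    simp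

theorem integrable_famSymbol {α t δ a b σ : ℝ} (hδ : 0 < δ) (ha : 0 < a) (z : ℂ) :
    Integrable (famSymbol α t δ a b σ z) :=
  ((integrable_regSymbol hδ ha).norm.const_mul _).mono'
    (measurable_famSymbol α t δ a b σ z).aestronglyMeasurable
    (Eventually.of_forall fun p => norm_famSymbol_le ha le_rfl p)

theorem norm_famSymbol_le_one {α t δ a b σ : ℝ} (hδ : 0 ≤ δ) (ha : 0 < a) {z : ℂ} (hz : z.re = 0)
    (p : ℝ × ℝ) : ‖famSymbol α t δ a b σ z p‖ ≤ 1 := by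
  refine (norm_famSymbol_le ha (R := 0) (by simp [hz]) p).trans ?_
  simpa using norm_regSymbol_le_one hδ p

theorem ofReal_mul_cpow {r : ℝ} (hr : 0 < r) {z : ℂ} (hz : z ≠ 0) (w : ℂ) :
    ((r : ℂ) * z) ^ w = (r : ℂ) ^ w * z ^ w := by
  have hr' : (r : ℂ) ≠ 0 := by exact_mod_cast hr.ne'
  rw [Complex.cpow_def_of_ne_zero (mul_ne_zero hr' hz), Complex.cpow_def_of_ne_zero hr',
    Complex.cpow_def_of_ne_zero hz, Complex.log_ofReal_mul hr hz, ← Complex.exp_add,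
    Complex.ofReal_log hr.le]
  ring_nf

/-- The integral in the second variable of the kernel of the family at `Re z = 1`. -/
theorem integral_famSymbol_snd {α t δ ε a b γ s : ℝ} (hδ : 0 < δ) (hs : s = 1 ∨ s = -1)
    (w : ℝ × ℝ) {x : ℝ} (hx0 : 0 < x) (hx : x ∈ Set.Icc a b) :
    ∫ y : ℝ, Complex.exp (((2 * Real.pi * (w.1 * (s * x) + w.2 * y) : ℝ) : ℂ) * Complex.I) *
      famSymbol α t δ a b (α / 2 - ε) (1 + γ * Complex.I) (s * x, y) =
    (Real.pi / (δ + (t * s : ℝ) * Complex.I)) ^ (1 / 2 : ℂ) *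
      ((x : ℂ) ^ (-(ε : ℂ) + (γ * (α / 2 - ε) : ℝ) * Complex.I) *
      (((Real.exp (-((Real.pi ^ 2 * w.2 ^ 2 * δ / (δ ^ 2 + t ^ 2)) * x ^ (-α))) : ℝ) : ℂ) *
      Complex.exp ((((-(t * s)) * x ^ 3 + (2 * Real.pi * w.1 * s) * x -
        (-(t * s) * (Real.pi ^ 2 * w.2 ^ 2 / (δ ^ 2 + t ^ 2))) * x ^ (-α) : ℝ) : ℂ) * Complex.I))) := by
  have hpi := Real.pi_pos
  have hs2 : s ^ 2 = 1 := by rcases hs with rfl | rfl <;> norm_num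
  have habs : |s * x| = x := by
    rcases hs with rfl | rfl
    · rw [one_mul, abs_of_pos hx0]
    · rw [neg_one_mul, abs_neg, abs_of_pos hx0]
  have hsign : Real.sign (s * x) = s := by
    rcases hs with rfl | rfl
    · rw [one_mul, Real.sign_of_pos hx0]
    · rw [neg_one_mul, Real.sign_of_neg (by linarith)]
  have hmem : ∀ y : ℝ, (s * x, y) ∈ freqShell a b := fun y => by
    simpa [freqShell, habs] using hx
  set β : ℂ := (δ : ℂ) + (t * s : ℝ) * Complex.I with hβ
  have hβre : β.re = δ := by simp [hβ]
  have hβ0 : β ≠ 0 := fun h => by rw [h] at hβre; simp at hβre; linarith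
  have hxa : 0 < x ^ α := Real.rpow_pos_of_pos hx0 _
  have hxc : (x : ℂ) ≠ 0 := by exact_mod_cast hx0.ne'
  have hg := integral_phase_mul_gaussian (b := ((x ^ α : ℝ) : ℂ) * β) (by
    rw [Complex.re_ofReal_mul, hβre]; positivity) w.2
  have hden : (δ ^ 2 + t ^ 2 : ℝ) ≠ 0 := by positivity
  have hinv : β⁻¹ = ((δ / (δ ^ 2 + t ^ 2) : ℝ) : ℂ) - ((t * s / (δ ^ 2 + t ^ 2) : ℝ) : ℂ) * Complex.I := by
    have hc : (δ ^ 2 + t ^ 2 : ℂ) ≠ 0 := by exact_mod_cast hden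
    have hsc : (s : ℂ) ^ 2 = 1 := by exact_mod_cast hs2
    apply inv_eq_of_mul_eq_one_right
    rw [hβ]
    push_cast
    field_simp
    linear_combination (-(t : ℂ) ^ 2 * s ^ 2) * Complex.I_sq + (t : ℂ) ^ 2 * hsc
  have e1 : (Real.pi / (((x ^ α : ℝ) : ℂ) * β)) ^ (1 / 2 : ℂ) =
      (x : ℂ) ^ (-(α / 2 : ℝ) : ℂ) * (Real.pi / β) ^ (1 / 2 : ℂ) := by
    rw [show (Real.pi / (((x ^ α : ℝ) : ℂ) * β)) = ((x ^ (-α) : ℝ) : ℂ) * (Real.pi / β) by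
      rw [Real.rpow_neg hx0.le, Complex.ofReal_inv]; field_simp,
      ofReal_mul_cpow (by positivity) (div_ne_zero (by exact_mod_cast hpi.ne') hβ0)]
    congr 1
    rw [show (1 / 2 : ℂ) = ((1 / 2 : ℝ) : ℂ) by norm_num, ← Complex.ofReal_cpow (by positivity),
      ← Real.rpow_mul hx0.le, ← Complex.ofReal_neg, ← Complex.ofReal_cpow hx0.le]
    congr 2
    ring
  have e2 : -((Real.pi ^ 2 * w.2 ^ 2 : ℝ) : ℂ) / (((x ^ α : ℝ) : ℂ) * β) =
      ((-((Real.pi ^ 2 * w.2 ^ 2 * δ / (δ ^ 2 + t ^ 2)) * x ^ (-α)) : ℝ) : ℂ) +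
      ((t * s * (Real.pi ^ 2 * w.2 ^ 2 / (δ ^ 2 + t ^ 2)) * x ^ (-α) : ℝ) : ℂ) * Complex.I := by
    rw [div_eq_mul_inv, mul_inv, ← Complex.ofReal_inv, ← Real.rpow_neg hx0.le, hinv]
    push_cast
    ring
  rw [e1, e2] at hg
  have hl : ∀ y : ℝ, Complex.exp (((2 * Real.pi * (w.1 * (s * x) + w.2 * y) : ℝ) : ℂ) * Complex.I) *
      famSymbol α t δ a b (α / 2 - ε) (1 + γ * Complex.I) (s * x, y) =
      ((x : ℂ) ^ ((1 + γ * Complex.I) * (α / 2 - ε : ℝ)) *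
        Complex.exp (((-(t * s) * x ^ 3 + (2 * Real.pi * w.1 * s) * x : ℝ) : ℂ) * Complex.I)) *
      (Complex.exp (((2 * Real.pi * (w.2 * y) : ℝ) : ℂ) * Complex.I) *
      Complex.exp (-(((x ^ α : ℝ) : ℂ) * β) * (y : ℂ) ^ 2)) := by
    intro y
    rw [famSymbol, regSymbol, Set.indicator_of_mem (hmem y), groupSymbol]
    simp only [habs, hsign]
    have key : Complex.exp (((2 * Real.pi * (w.1 * (s * x) + w.2 * y) : ℝ) : ℂ) * Complex.I) *
        (((Real.exp (-(δ * x ^ α * y ^ 2)) : ℝ) : ℂ) * Complex.exp (-Complex.I * (t : ℂ) *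
          (((s * x) ^ 3 + s * x ^ α * y ^ 2 : ℝ) : ℂ))) =
        Complex.exp (((-(t * s) * x ^ 3 + (2 * Real.pi * w.1 * s) * x : ℝ) : ℂ) * Complex.I) *
        (Complex.exp (((2 * Real.pi * (w.2 * y) : ℝ) : ℂ) * Complex.I) *
        Complex.exp (-(((x ^ α : ℝ) : ℂ) * β) * (y : ℂ) ^ 2)) := by
      rw [Complex.ofReal_exp, ← Complex.exp_add, ← Complex.exp_add, ← Complex.exp_add,
        ← Complex.exp_add, hβ]
      congr 1
      rcases hs with rfl | rfl <;> push_cast <;> ring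
    linear_combination ((x : ℂ) ^ ((1 + γ * Complex.I) * (α / 2 - ε : ℝ))) * key
  simp_rw [hl]
  rw [integral_const_mul, hg]
  have hA : (x : ℂ) ^ ((1 + γ * Complex.I) * (α / 2 - ε : ℝ)) * (x : ℂ) ^ (-(α / 2 : ℝ) : ℂ) =
      (x : ℂ) ^ (-(ε : ℂ) + (γ * (α / 2 - ε) : ℝ) * Complex.I) := by
    rw [← Complex.cpow_add _ _ hxc]
    congr 1
    push_cast
    ring
  have hB : Complex.exp (((-(t * s) * x ^ 3 + (2 * Real.pi * w.1 * s) * x : ℝ) : ℂ) * Complex.I) *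
      Complex.exp (((-((Real.pi ^ 2 * w.2 ^ 2 * δ / (δ ^ 2 + t ^ 2)) * x ^ (-α)) : ℝ) : ℂ) +
      ((t * s * (Real.pi ^ 2 * w.2 ^ 2 / (δ ^ 2 + t ^ 2)) * x ^ (-α) : ℝ) : ℂ) * Complex.I) =
      ((Real.exp (-((Real.pi ^ 2 * w.2 ^ 2 * δ / (δ ^ 2 + t ^ 2)) * x ^ (-α))) : ℝ) : ℂ) *
      Complex.exp ((((-(t * s)) * x ^ 3 + (2 * Real.pi * w.1 * s) * x -
        (-(t * s) * (Real.pi ^ 2 * w.2 ^ 2 / (δ ^ 2 + t ^ 2))) * x ^ (-α) : ℝ) : ℂ) * Complex.I) := by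
    rw [Complex.ofReal_exp, ← Complex.exp_add, ← Complex.exp_add]
    congr 1
    push_cast
    ring
  generalize Complex.exp (((-(t * s) * x ^ 3 + (2 * Real.pi * w.1 * s) * x : ℝ) : ℂ) * Complex.I) = E1 at *
  generalize (Real.pi / β) ^ (1 / 2 : ℂ) = Q at *
  rw [← hA, ← hB]
  ring

theorem norm_sqrt_pi_div_le {δ r t : ℝ} (hr : |r| = |t|) (ht : t ≠ 0) :
    ‖(Real.pi / ((δ : ℂ) + (r : ℂ) * Complex.I)) ^ (1 / 2 : ℂ)‖ ≤ √Real.pi * |t| ^ (-(1 / 2) : ℝ) := by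
  have hpi := Real.pi_pos
  have ht' : 0 < |t| := abs_pos.2 ht
  rw [show (1 / 2 : ℂ) = ((1 / 2 : ℝ) : ℂ) by norm_num, Complex.norm_cpow_real, norm_div,
    Complex.norm_real, Real.norm_of_nonneg hpi.le, Real.rpow_neg ht'.le, Real.sqrt_eq_rpow,
    ← div_eq_mul_inv, ← Real.div_rpow hpi.le ht'.le]
  have h : |t| ≤ ‖(δ : ℂ) + (r : ℂ) * Complex.I‖ := by
    have := Complex.abs_im_le_norm ((δ : ℂ) + (r : ℂ) * Complex.I)
    simpa [hr] using this
  gcongr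

/-- Dispersive bound for the kernel of the family on the line `Re z = 1`. -/
theorem norm_IFT2_famSymbol_le {α t δ ε a b : ℝ} (hε : 0 < ε) (hε1 : ε < 1) (hα : -1 ≤ α) (hα2 : α ≤ 1)
    (ht : t ≠ 0) (hδ : 0 < δ) (ha : 0 < a) (hab : a ≤ b) (γ : ℝ) (w : ℝ × ℝ) :
    ‖IFT2 (famSymbol α t δ a b (α / 2 - ε) (1 + γ * Complex.I)) w‖ ≤
      4 * √Real.pi * (1 / (1 - ε) + 88 + 44 / ε) * (1 + |γ|) * |t| ^ (-(5 - 2 * ε) / 6) := by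
  have hpi := Real.pi_pos
  have ht' : 0 < |t| := abs_pos.2 ht
  have hε1' : 0 < 1 - ε := by linarith
  set A := √Real.pi * |t| ^ (-(1 / 2) : ℝ) * ((1 / (1 - ε) + 88 + 44 / ε) * (1 + |γ * (α / 2 - ε)|) *
      |t| ^ (-(1 - ε) / 3)) with hA
  have h_int := (integrable_phase_mul_iff w).2
    (integrable_famSymbol (α := α) (t := t) (b := b) (σ := α / 2 - ε) hδ ha (1 + γ * Complex.I))
  set H : ℝ → ℂ := fun x => ∫ y : ℝ,
    Complex.exp (((2 * Real.pi * (w.1 * x + w.2 * y) : ℝ) : ℂ) * Complex.I) *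
      famSymbol α t δ a b (α / 2 - ε) (1 + γ * Complex.I) (x, y) with hH
  have hHi : Integrable H := h_int.integral_prod_left
  have hI : IFT2 (famSymbol α t δ a b (α / 2 - ε) (1 + γ * Complex.I)) w = ∫ x, H x :=
    integral_prod _ h_int
  have hhalf : ∀ s : ℝ, s = 1 ∨ s = -1 → ‖∫ x in Set.Ioi 0, H (s * x)‖ ≤ A := by
    intro s hs
    have habs : ∀ x, |s * x| = |x| := by
      intro x
      rcases hs with rfl | rfl <;> simp
    have h1 : ∫ x in Set.Ioi 0, H (s * x) = ∫ x in Set.Icc a b, H (s * x) := by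
      refine setIntegral_eq_of_subset_of_forall_sdiff_eq_zero measurableSet_Ioi
        (fun x hx => ha.trans_le hx.1) (fun x hx => ?_)
      have hx0 : 0 < x := hx.1
      have : ∀ y, famSymbol α t δ a b (α / 2 - ε) (1 + γ * Complex.I) (s * x, y) = 0 := by
        intro y
        rw [famSymbol, regSymbol_eq_zero, mul_zero]
        intro h
        have h2 : a ≤ |s * x| ∧ |s * x| ≤ b := h
        rw [habs, abs_of_pos hx0] at h2
        exact hx.2 h2
      simp [hH, this]
    rw [h1, integral_Icc_eq_integral_Ioc, ← intervalIntegral.integral_of_le hab]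
    have h2 : ∫ x in a..b, H (s * x) = ∫ x in a..b, (Real.pi / (δ + (t * s : ℝ) * Complex.I)) ^ (1 / 2 : ℂ) *
      ((x : ℂ) ^ (-(ε : ℂ) + (γ * (α / 2 - ε) : ℝ) * Complex.I) *
      (((Real.exp (-((Real.pi ^ 2 * w.2 ^ 2 * δ / (δ ^ 2 + t ^ 2)) * x ^ (-α))) : ℝ) : ℂ) *
      Complex.exp ((((-(t * s)) * x ^ 3 + (2 * Real.pi * w.1 * s) * x -
        (-(t * s) * (Real.pi ^ 2 * w.2 ^ 2 / (δ ^ 2 + t ^ 2))) * x ^ (-α) : ℝ) : ℂ) * Complex.I))) := by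
      refine intervalIntegral.integral_congr fun x hx => ?_
      rw [Set.uIcc_of_le hab] at hx
      exact integral_famSymbol_snd hδ hs w (ha.trans_le hx.1) hx
    have hts : |t * s| = |t| := by
      rcases hs with rfl | rfl <;> simp
    rw [h2, intervalIntegral.integral_const_mul, norm_mul]
    have hts0 : -(t * s) ≠ 0 := by
      intro h
      rw [neg_eq_zero] at h
      rw [h, abs_zero] at hts
      linarith
    have h3 := norm_integral_power_phase_le (ε := ε) (α := α) (T := -(t * s))
      (X := 2 * Real.pi * w.1 * s) (c := -(t * s) * (Real.pi ^ 2 * w.2 ^ 2 / (δ ^ 2 + t ^ 2)))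
      (D := Real.pi ^ 2 * w.2 ^ 2 * δ / (δ ^ 2 + t ^ 2)) (τ := γ * (α / 2 - ε)) (a := a) (b := b)
      hε hε1 hα hts0 (by
        rw [← mul_assoc]
        exact mul_nonneg (mul_self_nonneg _) (by positivity)) (by positivity) ha hab
    rw [abs_neg, hts] at h3
    exact mul_le_mul (norm_sqrt_pi_div_le hts ht) h3 (norm_nonneg _) (by positivity)
  have hsplit : ∫ x, H x = (∫ x in Set.Ioi 0, H (-1 * x)) + ∫ x in Set.Ioi 0, H (1 * x) := by
    rw [← intervalIntegral.integral_Iic_add_Ioi (b := 0) hHi.integrableOn hHi.integrableOn]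
    simp_rw [neg_one_mul, one_mul]
    rw [integral_comp_neg_Ioi, neg_zero]
  rw [hI, hsplit]
  refine (norm_add_le _ _).trans ((add_le_add (hhalf (-1) (Or.inr rfl)) (hhalf 1 (Or.inl rfl))).trans ?_)
  have hσ : |α / 2 - ε| ≤ 2 := abs_le.2 ⟨by linarith, by linarith⟩
  have h4 : 1 + |γ * (α / 2 - ε)| ≤ 2 * (1 + |γ|) := by
    rw [abs_mul]
    nlinarith [abs_nonneg γ]
  have h5 : |t| ^ (-(5 - 2 * ε) / 6) = |t| ^ (-(1 / 2) : ℝ) * |t| ^ (-(1 - ε) / 3) := by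
    rw [← Real.rpow_add ht']
    ring_nf
  have h6 : A ≤ √Real.pi * |t| ^ (-(1 / 2) : ℝ) * ((1 / (1 - ε) + 88 + 44 / ε) * (2 * (1 + |γ|)) *
      |t| ^ (-(1 - ε) / 3)) := by
    rw [hA]
    gcongr
  rw [h5]
  nlinarith [h6]

/-- The bilinear form `(f, g) ↦ ∫ M_z f̂ ǧ` attached to the family of truncated symbols. -/
def famPair (α t δ a b σ : ℝ) (z : ℂ) (f g : ℝ × ℝ → ℂ) : ℂ :=
  ∫ p, famSymbol α t δ a b σ z p * (FT2 f p * IFT2 g p)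

theorem lintegral_IFT2_sq_le {f : ℝ × ℝ → ℂ} (hf : Integrable f) :
    ∫⁻ p, ‖IFT2 f p‖ₑ ^ 2 ≤ ∫⁻ x, ‖f x‖ₑ ^ 2 := by
  simp_rw [IFT2_eq_FT2_neg]
  rw [lintegral_neg_eq_self (fun p => ‖FT2 f p‖ₑ ^ 2)]
  exact lintegral_FT2_sq_le hf

theorem integrable_famSymbol_mul {α t δ a b σ : ℝ} (hδ : 0 < δ) (ha : 0 < a) (z : ℂ)
    {f g : ℝ × ℝ → ℂ} (hf : Integrable f) (hg : Integrable g) :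
    Integrable fun p => famSymbol α t δ a b σ z p * (FT2 f p * IFT2 g p) := by
  refine (integrable_famSymbol hδ ha z).mul_bdd (c := (∫ x, ‖f x‖) * ∫ x, ‖g x‖)
    ((continuous_FT2 hf).mul (continuous_IFT2 hg)).aestronglyMeasurable
    (Eventually.of_forall fun p => ?_)
  rw [norm_mul]
  exact mul_le_mul (norm_FT2_le f p) (norm_IFT2_le g p) (norm_nonneg _)
    (integral_nonneg fun _ => norm_nonneg _)

theorem enorm_famPair_le_of_re_eq_zero {α t δ a b σ : ℝ} (hδ : 0 < δ) (ha : 0 < a) {z : ℂ}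
    (hz : z.re = 0) {f g : ℝ × ℝ → ℂ} (hf : Integrable f) (hg : Integrable g) :
    ‖famPair α t δ a b σ z f g‖ₑ ≤
      (∫⁻ x, ‖f x‖ₑ ^ 2) ^ (1 / 2 : ℝ) * (∫⁻ x, ‖g x‖ₑ ^ 2) ^ (1 / 2 : ℝ) := by
  calc _ ≤ ∫⁻ p, ‖famSymbol α t δ a b σ z p * (FT2 f p * IFT2 g p)‖ₑ :=
        enorm_integral_le_lintegral_enorm _
    _ ≤ ∫⁻ p, ‖FT2 f p‖ₑ * ‖IFT2 g p‖ₑ := by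
        refine lintegral_mono fun p => ?_
        rw [enorm_mul, enorm_mul]
        refine mul_le_of_le_one_left zero_le ?_
        rw [← ofReal_norm, ← ENNReal.ofReal_one]
        exact ENNReal.ofReal_le_ofReal (norm_famSymbol_le_one hδ.le ha hz p)
    _ ≤ (∫⁻ p, ‖FT2 f p‖ₑ ^ (2 : ℝ)) ^ (1 / 2 : ℝ) * (∫⁻ p, ‖IFT2 g p‖ₑ ^ (2 : ℝ)) ^ (1 / 2 : ℝ) :=
        ENNReal.lintegral_mul_le_Lp_mul_Lq volume Real.HolderConjugate.two_two
          (continuous_FT2 hf).aestronglyMeasurable.enorm (continuous_IFT2 hg).aestronglyMeasurable.enorm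
    _ ≤ _ := by
        simp_rw [ENNReal.rpow_two]
        refine mul_le_mul' (ENNReal.rpow_le_rpow ?_ (by norm_num)) (ENNReal.rpow_le_rpow ?_ (by norm_num))
        · exact lintegral_FT2_sq_le hf
        · exact lintegral_IFT2_sq_le hg

theorem norm_famPair_le_of_re_eq_zero {α t δ a b σ : ℝ} (hδ : 0 < δ) (ha : 0 < a) {z : ℂ}
    (hz : z.re = 0) {f g : ℝ × ℝ → ℂ} (hf : Integrable f) (hg : Integrable g)
    (hf2 : Integrable fun x => ‖f x‖ ^ 2) (hg2 : Integrable fun x => ‖g x‖ ^ 2) :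
    ‖famPair α t δ a b σ z f g‖ ≤
      (∫ x, ‖f x‖ ^ 2) ^ (1 / 2 : ℝ) * (∫ x, ‖g x‖ ^ 2) ^ (1 / 2 : ℝ) := by
  have hconv : ∀ {h : ℝ × ℝ → ℂ}, (Integrable fun x => ‖h x‖ ^ 2) →
      (∫⁻ x, ‖h x‖ₑ ^ 2) = ENNReal.ofReal (∫ x, ‖h x‖ ^ 2) := by
    intro h hh
    rw [ofReal_integral_eq_lintegral_ofReal hh (Eventually.of_forall fun p => by positivity)]
    simp_rw [ENNReal.ofReal_pow (norm_nonneg _), ofReal_norm]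
  have h := enorm_famPair_le_of_re_eq_zero (α := α) (t := t) (b := b) (σ := σ) hδ ha hz hf hg
  have h0 : ∀ h : ℝ × ℝ → ℂ, 0 ≤ ∫ x, ‖h x‖ ^ 2 := fun h => integral_nonneg fun _ => by positivity
  rw [hconv hf2, hconv hg2, ENNReal.ofReal_rpow_of_nonneg (h0 f) (by norm_num),
    ENNReal.ofReal_rpow_of_nonneg (h0 g) (by norm_num), ← ENNReal.ofReal_mul
    (Real.rpow_nonneg (h0 f) _), ← ofReal_norm] at h
  exact (ENNReal.ofReal_le_ofReal_iff (mul_nonneg (Real.rpow_nonneg (h0 f) _)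
    (Real.rpow_nonneg (h0 g) _))).1 h

theorem norm_famPair_le_of_kernel {α t δ a b σ K : ℝ} (hδ : 0 < δ) (ha : 0 < a) {z : ℂ}
    (hK : ∀ w, ‖IFT2 (famSymbol α t δ a b σ z) w‖ ≤ K) {f g : ℝ × ℝ → ℂ} (hf : Integrable f)
    (hg : Integrable g) :
    ‖famPair α t δ a b σ z f g‖ ≤ K * ((∫ x, ‖f x‖) * ∫ x, ‖g x‖) := by
  have hM := integrable_famSymbol (α := α) (t := t) (b := b) (σ := σ) hδ ha z
  have hMf : Integrable fun p => famSymbol α t δ a b σ z p * FT2 f p :=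
    hM.mul_bdd (c := ∫ x, ‖f x‖) (continuous_FT2 hf).aestronglyMeasurable
      (Eventually.of_forall (norm_FT2_le f))
  have h : famPair α t δ a b σ z f g =
      ∫ x, IFT2 (fun p => famSymbol α t δ a b σ z p * FT2 f p) x * g x := by
    rw [integral_IFT2_mul hMf hg, famPair]
    simp_rw [mul_assoc]
  rw [h, ← mul_assoc, ← integral_const_mul]
  refine norm_integral_le_of_norm_le (hg.norm.const_mul _) (Eventually.of_forall fun x => ?_)
  rw [norm_mul]
  exact mul_le_mul_of_nonneg_right (norm_IFT2_mul_FT2_le hM hf hK x) (norm_nonneg _)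

theorem norm_famPair_le_of_re {α t δ a b σ R : ℝ} (hδ : 0 < δ) (ha : 0 < a) {z : ℂ} (hz : |z.re| ≤ R)
    (f g : ℝ × ℝ → ℂ) :
    ‖famPair α t δ a b σ z f g‖ ≤ (∫ p, Real.exp (R * |σ| * (|Real.log a| + |Real.log b|)) *
      ‖regSymbol α t δ a b p‖) * ((∫ x, ‖f x‖) * ∫ x, ‖g x‖) := by
  rw [← integral_mul_const, famPair]
  refine norm_integral_le_of_norm_le (((integrable_regSymbol hδ ha).norm.const_mul _).mul_const _)
    (Eventually.of_forall fun p => ?_)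
  rw [norm_mul, norm_mul]
  refine mul_le_mul (norm_famSymbol_le ha hz p) (mul_le_mul (norm_FT2_le f p) (norm_IFT2_le g p)
    (norm_nonneg _) (integral_nonneg fun _ => norm_nonneg _)) (by positivity) (by positivity)

theorem differentiable_famPair {α t δ a b σ : ℝ} (hδ : 0 < δ) (ha : 0 < a)
    {f g : ℝ × ℝ → ℂ} (hf : Integrable f) (hg : Integrable g) :
    Differentiable ℂ fun z => famPair α t δ a b σ z f g := by
  intro z₀
  set L := |Real.log a| + |Real.log b| with hL
  set R := |z₀.re| + 1 with hR
  have hmeas : AEStronglyMeasurable (fun p => FT2 f p * IFT2 g p) :=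
    ((continuous_FT2 hf).mul (continuous_IFT2 hg)).aestronglyMeasurable
  have hbound : ∀ p, ‖FT2 f p * IFT2 g p‖ ≤ (∫ x, ‖f x‖) * ∫ x, ‖g x‖ := by
    intro p
    rw [norm_mul]
    exact mul_le_mul (norm_FT2_le f p) (norm_IFT2_le g p) (norm_nonneg _)
      (integral_nonneg fun _ => norm_nonneg _)
  refine (hasDerivAt_integral_of_dominated_loc_of_deriv_le (μ := volume) (s := Metric.ball z₀ 1)
    (F := fun z p => famSymbol α t δ a b σ z p * (FT2 f p * IFT2 g p))
    (F' := fun z p => (((Real.log |p.1| * σ : ℝ) : ℂ) * famSymbol α t δ a b σ z p) *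
      (FT2 f p * IFT2 g p))
    (bound := fun p => (L * |σ|) * (Real.exp (R * |σ| * L) * ‖regSymbol α t δ a b p‖) *
      ((∫ x, ‖f x‖) * ∫ x, ‖g x‖))
    (Metric.ball_mem_nhds z₀ one_pos)
    (Eventually.of_forall fun z => (integrable_famSymbol_mul hδ ha z hf hg).aestronglyMeasurable)
    (integrable_famSymbol_mul hδ ha z₀ hf hg) ?_ (Eventually.of_forall fun p z hz => ?_)
    ((((integrable_regSymbol hδ ha).norm.const_mul _).const_mul _).mul_const _)
    (Eventually.of_forall fun p z hz => ?_)).2.differentiableAt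
  · refine AEStronglyMeasurable.mul (Measurable.aestronglyMeasurable ?_) hmeas
    exact Measurable.mul (Measurable.complex_ofReal (by fun_prop)) (measurable_famSymbol _ _ _ _ _ _ _)
  · have hzR : |z.re| ≤ R := by
      have h1 := (Complex.abs_re_le_norm (z - z₀)).trans (mem_ball_iff_norm.1 hz).le
      rw [Complex.sub_re] at h1
      have := abs_sub_abs_le_abs_sub z.re z₀.re
      linarith
    rw [norm_mul, norm_mul]
    have hb := hbound p
    by_cases hp : p ∈ freqShell a b
    · refine mul_le_mul (mul_le_mul ?_ (norm_famSymbol_le ha hzR p) (norm_nonneg _) (by positivity))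
        hb (norm_nonneg _) (by positivity)
      rw [Complex.norm_real, Real.norm_eq_abs, abs_mul]
      gcongr
      exact abs_log_le_of_mem ha hp.1 hp.2
    · rw [famSymbol, regSymbol_eq_zero hp]
      simp
  · by_cases hp : p ∈ freqShell a b
    · have hp0 : 0 < |p.1| := ha.trans_le hp.1
      have hpc : ((|p.1| : ℝ) : ℂ) ≠ 0 := by exact_mod_cast hp0.ne'
      have h1 : HasDerivAt (fun z : ℂ => z * (σ : ℂ)) σ z := by
        simpa using (hasDerivAt_id z).mul_const (σ : ℂ)
      have h2 := ((h1.const_cpow (c := ((|p.1| : ℝ) : ℂ)) (Or.inl hpc)).mul_const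
        (regSymbol α t δ a b p)).mul_const (FT2 f p * IFT2 g p)
      refine h2.congr_deriv ?_
      rw [famSymbol, Complex.ofReal_mul, Complex.ofReal_log hp0.le]
      ring
    · simp only [famSymbol, regSymbol_eq_zero hp, mul_zero, zero_mul]
      exact hasDerivAt_const _ _

theorem FT2_sum {ι : Type*} (S : Finset ι) (c : ι → ℂ) {e : ι → ℝ × ℝ → ℂ} (he : ∀ i ∈ S, Integrable (e i))
    (p : ℝ × ℝ) : FT2 (fun x => ∑ i ∈ S, c i * e i x) p = ∑ i ∈ S, c i * FT2 (e i) p := by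
  have hi : ∀ i ∈ S, Integrable fun q : ℝ × ℝ => Complex.exp (-((2 * Real.pi * (p.1 * q.1 + p.2 * q.2) : ℝ) : ℂ) *
      Complex.I) * e i q := by
    intro i h
    refine ((integrable_phase_mul_iff (-p)).2 (he i h)).congr (Eventually.of_forall fun q => ?_)
    simp only [Prod.fst_neg, Prod.snd_neg]
    rw [← Complex.ofReal_neg]
    ring_nf
  unfold FT2
  simp_rw [Finset.mul_sum, mul_left_comm _ (c _)]
  rw [integral_finsetSum _ fun i h => (hi i h).const_mul _]
  simp_rw [integral_const_mul]

theorem famPair_sum {α t δ a b σ : ℝ} (hδ : 0 < δ) (ha : 0 < a) (z : ℂ) {ι κ : Type*}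
    (S : Finset ι) (T : Finset κ) (c : ι → ℂ) (d : κ → ℂ) {e : ι → ℝ × ℝ → ℂ} {h : κ → ℝ × ℝ → ℂ}
    (he : ∀ i ∈ S, Integrable (e i)) (hh : ∀ j ∈ T, Integrable (h j)) :
    famPair α t δ a b σ z (fun x => ∑ i ∈ S, c i * e i x) (fun x => ∑ j ∈ T, d j * h j x) =
      ∑ i ∈ S, ∑ j ∈ T, c i * d j * famPair α t δ a b σ z (e i) (h j) := by
  unfold famPair
  simp_rw [IFT2_eq_FT2_neg, FT2_sum S c he, FT2_sum T d hh, ← IFT2_eq_FT2_neg, Finset.sum_mul_sum,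
    Finset.mul_sum]
  have h_int := fun i (hi : i ∈ S) j (hj : j ∈ T) =>
    (integrable_famSymbol_mul (α := α) (t := t) (b := b) (σ := σ) hδ ha z (he i hi) (hh j hj)).const_mul
      (c i * d j)
  have hcongr : ∀ i j p, famSymbol α t δ a b σ z p * (c i * FT2 (e i) p * (d j * IFT2 (h j) p)) =
      c i * d j * (famSymbol α t δ a b σ z p * (FT2 (e i) p * IFT2 (h j) p)) := fun i j p => by ring
  simp_rw [hcongr]
  rw [integral_finsetSum _ fun i hi => integrable_finsetSum _ fun j hj => h_int i hi j hj]
  refine Finset.sum_congr rfl fun i hi => ?_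
  rw [integral_finsetSum _ fun j hj => h_int i hi j hj]
  simp_rw [integral_const_mul]

/-- The analytic deformation `a ↦ a |a|^{q(1+z)/2 - 1}` of the values of a simple function. -/
def steinCoef (q : ℝ) (z a : ℂ) : ℂ :=
  if a = 0 then 0 else (a / ‖a‖) * ((‖a‖ : ℝ) : ℂ) ^ ((q : ℂ) * (1 + z) / 2)

theorem steinCoef_zero (q : ℝ) (z : ℂ) : steinCoef q z 0 = 0 := if_pos rfl

theorem norm_steinCoef {q : ℝ} (hq : 0 < q) {z : ℂ} (hz : 0 ≤ z.re) (a : ℂ) :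
    ‖steinCoef q z a‖ = ‖a‖ ^ (q * (1 + z.re) / 2) := by
  unfold steinCoef
  split_ifs with h
  · have : q * (1 + z.re) / 2 ≠ 0 := by positivity
    rw [h, norm_zero, Real.zero_rpow this]
  · have ha : 0 < ‖a‖ := norm_pos_iff.2 h
    rw [norm_mul, norm_div, Complex.norm_real, norm_norm, div_self ha.ne', one_mul,
      Complex.norm_cpow_eq_rpow_re_of_pos ha]
    congr 1
    rw [show (q : ℂ) * (1 + z) / 2 = ((q / 2 : ℝ) : ℂ) * (1 + z) by push_cast; ring,
      Complex.re_ofReal_mul]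
    simp
    ring

theorem steinCoef_of_eq_one {q : ℝ} {z : ℂ} (h : (q : ℂ) * (1 + z) / 2 = 1) (a : ℂ) :
    steinCoef q z a = a := by
  unfold steinCoef
  split_ifs with h0
  · exact h0.symm
  · rw [h, Complex.cpow_one]
    have : (‖a‖ : ℂ) ≠ 0 := by exact_mod_cast (norm_pos_iff.2 h0).ne'
    field_simp

theorem differentiable_steinCoef (q : ℝ) (a : ℂ) : Differentiable ℂ fun z => steinCoef q z a := by
  unfold steinCoef
  split_ifs with h
  · exact differentiable_const _
  · have : (‖a‖ : ℂ) ≠ 0 := by exact_mod_cast (norm_pos_iff.2 h).ne'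
    exact (Differentiable.const_cpow (by fun_prop) (Or.inl this)).const_mul _

/-- The indicator of the level set of `f` at a nonzero value. -/
def levelIndicator (f : SimpleFunc (ℝ × ℝ) ℂ) (a : ℂ) : ℝ × ℝ → ℂ :=
  if a = 0 then 0 else (f ⁻¹' {a}).indicator 1

theorem integrable_levelIndicator {f : SimpleFunc (ℝ × ℝ) ℂ} (hf : Integrable f) (a : ℂ) :
    Integrable (levelIndicator f a) := by
  unfold levelIndicator
  split_ifs with h
  · exact integrable_zero _ _ _
  · exact (integrable_indicator_iff (f.measurableSet_preimage _)).2
      (integrableOn_const (SimpleFunc.measure_preimage_lt_top_of_integrable f hf h).ne (by simp))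

theorem steinCoef_comp_eq_sum (q : ℝ) (z : ℂ) (f : SimpleFunc (ℝ × ℝ) ℂ) (x : ℝ × ℝ) :
    steinCoef q z (f x) = ∑ a ∈ f.range, steinCoef q z a * levelIndicator f a x := by
  rw [Finset.sum_eq_single (f x)]
  · unfold levelIndicator
    split_ifs with h
    · rw [h, steinCoef_zero, zero_mul]
    · simp
  · intro a _ ha
    unfold levelIndicator
    split_ifs with h
    · simp
    · rw [Set.indicator_of_notMem, mul_zero]
      exact fun hx => ha hx.symm
  · intro h
    exact absurd (f.mem_range_self x) h

theorem integrable_map_of_zero {E F : Type*} [NormedAddCommGroup E] [NormedAddCommGroup F]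
    {f : SimpleFunc (ℝ × ℝ) E} (hf : Integrable f) {g : E → F} (hg : g 0 = 0) :
    Integrable fun x => g (f x) :=
  ((SimpleFunc.integrable_iff_finMeasSupp.1 hf).map hg).integrable

theorem integrable_norm_rpow_of_simple {f : SimpleFunc (ℝ × ℝ) ℂ} (hf : Integrable f) {s : ℝ}
    (hs : s ≠ 0) : Integrable fun x => ‖f x‖ ^ s :=
  integrable_map_of_zero hf (g := fun a => ‖a‖ ^ s) (by simp [Real.zero_rpow hs])

theorem rpow_le_rpow_add_rpow {r s u v : ℝ} (hr : 0 ≤ r) (hu : 0 < u) (hus : u ≤ s) (hsv : s ≤ v) :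
    r ^ s ≤ r ^ u + r ^ v := by
  rcases hr.eq_or_lt with rfl | hr
  · rw [Real.zero_rpow (by linarith), Real.zero_rpow (by linarith), Real.zero_rpow (by linarith)]
    simp
  · rcases le_total r 1 with h | h
    · have := Real.rpow_le_rpow_of_exponent_ge hr h hus
      have := Real.rpow_nonneg hr.le v
      linarith
    · have := Real.rpow_le_rpow_of_exponent_le h hsv
      have := Real.rpow_nonneg hr.le u
      linarith

theorem norm_famPair_simple_le {α t δ ε a b θ : ℝ} (hε : 0 < ε) (hε1 : ε < 1) (hα : -1 ≤ α) (hα2 : α ≤ 1)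
    (ht : t ≠ 0) (hδ : 0 < δ) (ha : 0 < a) (hab : a ≤ b) (hθ : 0 ≤ θ) (hθ1 : θ ≤ 1) {q : ℝ}
    (hq : q * (1 + θ) = 2) {f g : SimpleFunc (ℝ × ℝ) ℂ} (hf : Integrable f) (hg : Integrable g) :
    ‖famPair α t δ a b (α / 2 - ε) θ f g‖ ≤
      Real.exp 1 * (8 * √Real.pi * (1 / (1 - ε) + 88 + 44 / ε)) ^ θ * |t| ^ (-(θ * (5 - 2 * ε)) / 6) *
      ((∫ x, ‖f x‖ ^ q) * ∫ x, ‖g x‖ ^ q) ^ (1 / q) := by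
  have hε1' : 0 < 1 - ε := by linarith
  have ht' : 0 < |t| := abs_pos.2 ht
  have hq0 : 0 < q := by
    by_contra h
    nlinarith
  set σ := α / 2 - ε with hσ
  set K := 4 * √Real.pi * (1 / (1 - ε) + 88 + 44 / ε) with hK
  have hK0 : 0 < K := by have := Real.pi_pos; positivity
  set Λ := |t| ^ (-(5 - 2 * ε) / 6) with hΛ
  have hΛ0 : 0 < Λ := Real.rpow_pos_of_pos ht' _
  set N := (∫ x, ‖f x‖ ^ q) * ∫ x, ‖g x‖ ^ q with hN
  have hf0 : 0 ≤ ∫ x, ‖f x‖ ^ q := integral_nonneg fun _ => by positivity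
  have hg0 : 0 ≤ ∫ x, ‖g x‖ ^ q := integral_nonneg fun _ => by positivity
  have hN0 : 0 ≤ N := mul_nonneg hf0 hg0
  set Φ : ℂ → ℂ := fun z => Complex.exp (z ^ 2 - 1) *
    famPair α t δ a b σ z (fun x => steinCoef q z (f x)) (fun x => steinCoef q z (g x)) with hΦ
  have hexp : ∀ z : ℂ, 0 ≤ z.re → z.re ≤ 1 → ‖Complex.exp (z ^ 2 - 1)‖ ≤ Real.exp (-z.im ^ 2) := by
    intro z h0 h1
    rw [Complex.norm_exp]
    apply Real.exp_le_exp.2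
    simp [sq]
    nlinarith
  have hfi : ∀ z, Integrable fun x => steinCoef q z (f x) :=
    fun z => integrable_map_of_zero hf (steinCoef_zero q z)
  have hgi : ∀ z, Integrable fun x => steinCoef q z (g x) :=
    fun z => integrable_map_of_zero hg (steinCoef_zero q z)
  have hΦd : Differentiable ℂ Φ := by
    have h1 : Φ = fun z => Complex.exp (z ^ 2 - 1) * ∑ i ∈ f.range, ∑ j ∈ g.range,
        steinCoef q z i * steinCoef q z j *
          famPair α t δ a b σ z (levelIndicator f i) (levelIndicator g j) := by
      funext z
      simp only [hΦ]
      simp_rw [steinCoef_comp_eq_sum]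
      rw [famPair_sum hδ ha z _ _ _ _ (fun i _ => integrable_levelIndicator hf i)
        (fun i _ => integrable_levelIndicator hg i)]
    rw [h1]
    refine Differentiable.mul (by fun_prop) (Differentiable.fun_sum fun i _ =>
      Differentiable.fun_sum fun j _ => ((differentiable_steinCoef q i).mul
        (differentiable_steinCoef q j)).mul (differentiable_famPair hδ ha
          (integrable_levelIndicator hf i) (integrable_levelIndicator hg j)))
  have hL1 : ∀ {u : SimpleFunc (ℝ × ℝ) ℂ}, Integrable u → ∀ z : ℂ, 0 ≤ z.re → z.re ≤ 1 →
      ∫ x, ‖steinCoef q z (u x)‖ ≤ ∫ x, (‖u x‖ ^ (q / 2) + ‖u x‖ ^ q) := by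
    intro u hu z h0 h1
    refine integral_mono (integrable_map_of_zero hu (steinCoef_zero q z)).norm
      ((integrable_norm_rpow_of_simple hu (by positivity)).add
        (integrable_norm_rpow_of_simple hu hq0.ne')) fun x => ?_
    simp only
    rw [norm_steinCoef hq0 h0]
    exact rpow_le_rpow_add_rpow (norm_nonneg _) (by positivity) (by nlinarith) (by nlinarith)
  have hB : BddAbove ((norm ∘ Φ) '' Complex.HadamardThreeLines.verticalClosedStrip 0 1) := by
    refine ⟨(∫ p, Real.exp (1 * |σ| * (|Real.log a| + |Real.log b|)) * ‖regSymbol α t δ a b p‖) *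
      ((∫ x, (‖f x‖ ^ (q / 2) + ‖f x‖ ^ q)) * ∫ x, (‖g x‖ ^ (q / 2) + ‖g x‖ ^ q)), ?_⟩
    rintro _ ⟨z, hz, rfl⟩
    have hz0 : 0 ≤ z.re := hz.1
    have hz1 : z.re ≤ 1 := hz.2
    simp only [Function.comp, hΦ]
    rw [norm_mul]
    have h1 : ‖Complex.exp (z ^ 2 - 1)‖ ≤ 1 := (hexp z hz0 hz1).trans (Real.exp_le_one_iff.2 (by nlinarith))
    refine (mul_le_of_le_one_left (norm_nonneg _) h1).trans
      ((norm_famPair_le_of_re hδ ha (R := 1) (abs_le.2 ⟨by linarith, hz1⟩) _ _).trans ?_)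
    refine mul_le_mul_of_nonneg_left (mul_le_mul (hL1 hf z hz0 hz1) (hL1 hg z hz0 hz1)
      (integral_nonneg fun _ => norm_nonneg _) (integral_nonneg fun _ => by positivity))
      (integral_nonneg fun _ => by positivity)
  have hA : ∀ z ∈ Complex.re ⁻¹' {0}, ‖Φ z‖ ≤ N ^ (1 / 2 : ℝ) := by
    intro z hz
    have hz0 : z.re = 0 := hz
    have h1 : ‖Complex.exp (z ^ 2 - 1)‖ ≤ 1 := (hexp z hz0.ge (by linarith)).trans
      (Real.exp_le_one_iff.2 (by nlinarith))
    have hsq : ∀ a : ℂ, ‖steinCoef q z a‖ ^ 2 = ‖a‖ ^ q := by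
      intro a
      rw [norm_steinCoef hq0 hz0.ge, hz0, ← Real.rpow_two, ← Real.rpow_mul (norm_nonneg _)]
      congr 1
      ring
    simp only [hΦ]
    rw [norm_mul]
    refine (mul_le_of_le_one_left (norm_nonneg _) h1).trans
      ((norm_famPair_le_of_re_eq_zero hδ ha hz0 (hfi z) (hgi z) ?_ ?_).trans (le_of_eq ?_))
    · simp_rw [hsq]
      exact integrable_norm_rpow_of_simple hf hq0.ne'
    · simp_rw [hsq]
      exact integrable_norm_rpow_of_simple hg hq0.ne'
    · simp_rw [hsq]
      rw [hN, Real.mul_rpow hf0 hg0]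
  have hB1 : ∀ z ∈ Complex.re ⁻¹' {1}, ‖Φ z‖ ≤ 2 * K * Λ * N := by
    intro z hz
    have hz1 : z.re = 1 := hz
    have h1 := hexp z (by linarith) hz1.le
    have hzz : z = 1 + (z.im : ℂ) * Complex.I := by
      apply Complex.ext <;> simp [hz1]
    have hk := norm_IFT2_famSymbol_le (a := a) (b := b) (δ := δ) hε hε1 hα hα2 ht hδ ha hab z.im
    rw [← hzz] at hk
    have hnorm : ∀ a : ℂ, ‖steinCoef q z a‖ = ‖a‖ ^ q := by
      intro a
      rw [norm_steinCoef hq0 (by linarith), hz1]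
      congr 1
      ring
    have h2 := norm_famPair_le_of_kernel hδ ha hk (hfi z) (hgi z)
    simp_rw [hnorm] at h2
    simp only [hΦ]
    rw [norm_mul]
    have h3 : Real.exp (-z.im ^ 2) * (1 + |z.im|) ≤ 2 := by
      rw [Real.exp_neg, inv_mul_le_iff₀ (Real.exp_pos _)]
      have := Real.add_one_le_exp (z.im ^ 2)
      rw [← sq_abs] at this ⊢
      nlinarith [sq_nonneg (|z.im| - 1)]
    calc _ ≤ Real.exp (-z.im ^ 2) * (K * (1 + |z.im|) * Λ * N) := by
          exact mul_le_mul h1 h2 (norm_nonneg _) (Real.exp_pos _).le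
      _ = (Real.exp (-z.im ^ 2) * (1 + |z.im|)) * (K * Λ * N) := by ring
      _ ≤ 2 * (K * Λ * N) := by gcongr
      _ = _ := by ring
  have hmain := Complex.HadamardThreeLines.norm_le_interp_of_mem_verticalClosedStrip₀₁' Φ (z := (θ : ℂ))
    (by exact ⟨by simpa using hθ, by simpa using hθ1⟩) hΦd.diffContOnCl hB hA hB1
  have hone : (q : ℂ) * (1 + θ) / 2 = 1 := by
    have : (q : ℂ) * (1 + θ) = 2 := by exact_mod_cast hq
    rw [this]
    norm_num
  simp only [hΦ, steinCoef_of_eq_one hone] at hmain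
  rw [norm_mul, Complex.ofReal_re] at hmain
  have he : Real.exp (-1) ≤ ‖Complex.exp ((θ : ℂ) ^ 2 - 1)‖ := by
    rw [Complex.norm_exp]
    apply Real.exp_le_exp.2
    simp [sq]
    nlinarith
  have h5 : ‖famPair α t δ a b σ θ f g‖ ≤ Real.exp 1 *
      ((N ^ (1 / 2 : ℝ)) ^ (1 - θ) * (2 * K * Λ * N) ^ θ) := by
    have h6 := (mul_le_mul_of_nonneg_right he (norm_nonneg (famPair α t δ a b σ θ f g))).trans hmain
    rwa [Real.exp_neg, inv_mul_le_iff₀ (Real.exp_pos _)] at h6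
  refine h5.trans (le_of_eq ?_)
  have hq' : 1 / q = (1 + θ) / 2 := by
    field_simp
    linarith
  rw [Real.mul_rpow (by positivity) hN0, Real.mul_rpow (by positivity) hΛ0.le, hq',
    show (1 + θ) / 2 = 1 / 2 * (1 - θ) + θ by ring, Real.rpow_add_of_nonneg hN0 (by nlinarith) hθ,
    Real.rpow_mul hN0, hΛ, ← Real.rpow_mul ht'.le,
    show -(5 - 2 * ε) / 6 * θ = -(θ * (5 - 2 * ε)) / 6 by ring,
    show 2 * K = 8 * √Real.pi * (1 / (1 - ε) + 88 + 44 / ε) by rw [hK]; ring]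
  ring

theorem FT2_congr_ae {f g : ℝ × ℝ → ℂ} (h : f =ᵐ[volume] g) : FT2 f = FT2 g := by
  funext p
  exact integral_congr_ae (h.mono fun x hx => by simp only [hx])

theorem tendsto_FT2_of_dominated {F : ℕ → ℝ × ℝ → ℂ} {f : ℝ × ℝ → ℂ} {bound : ℝ × ℝ → ℝ}
    (hF : ∀ n, AEStronglyMeasurable (F n)) (hb : Integrable bound) (hFb : ∀ n x, ‖F n x‖ ≤ bound x)
    (hlim : ∀ x, Tendsto (fun n => F n x) atTop (nhds (f x))) (p : ℝ × ℝ) :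
    Tendsto (fun n => FT2 (F n) p) atTop (nhds (FT2 f p)) := by
  refine tendsto_integral_of_dominated_convergence bound (fun n => ?_) hb (fun n =>
    Eventually.of_forall fun x => ?_) (Eventually.of_forall fun x => (hlim x).const_mul _)
  · exact (Continuous.aestronglyMeasurable (by fun_prop)).mul (hF n)
  · rw [← Complex.ofReal_neg, norm_cexp_ofReal_mul_I_mul]
    exact hFb n x

theorem norm_famPair_le_of_measurable {α t δ ε a b θ : ℝ} (hε : 0 < ε) (hε1 : ε < 1) (hα : -1 ≤ α)
    (hα2 : α ≤ 1) (ht : t ≠ 0) (hδ : 0 < δ) (ha : 0 < a) (hab : a ≤ b) (hθ : 0 ≤ θ) (hθ1 : θ ≤ 1)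
    {q : ℝ} (hq : q * (1 + θ) = 2) {f g : ℝ × ℝ → ℂ} (hf : Integrable f) (hg : Integrable g)
    (hfm : Measurable f) (hgm : Measurable g)
    (hfq : Integrable fun x => ‖f x‖ ^ q) (hgq : Integrable fun x => ‖g x‖ ^ q) :
    ‖famPair α t δ a b (α / 2 - ε) θ f g‖ ≤
      16 * Real.exp 1 * (8 * √Real.pi * (1 / (1 - ε) + 88 + 44 / ε)) ^ θ *
        |t| ^ (-(θ * (5 - 2 * ε)) / 6) * ((∫ x, ‖f x‖ ^ q) * ∫ x, ‖g x‖ ^ q) ^ (1 / q) := by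
  have hε1' : 0 < 1 - ε := by linarith
  have hq1 : 1 ≤ q := by
    by_contra h
    nlinarith
  have hq2 : q ≤ 2 := by nlinarith
  set F : ℕ → SimpleFunc (ℝ × ℝ) ℂ := fun n => SimpleFunc.approxOn f hfm Set.univ 0 (Set.mem_univ (0 : ℂ)) n with hF
  set G : ℕ → SimpleFunc (ℝ × ℝ) ℂ := fun n => SimpleFunc.approxOn g hgm Set.univ 0 (Set.mem_univ (0 : ℂ)) n with hG
  have hFb : ∀ n x, ‖F n x‖ ≤ 2 * ‖f x‖ := fun n x => by
    rw [two_mul]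
    exact SimpleFunc.norm_approxOn_zero_le hfm (Set.mem_univ (0 : ℂ)) x n
  have hGb : ∀ n x, ‖G n x‖ ≤ 2 * ‖g x‖ := fun n x => by
    rw [two_mul]
    exact SimpleFunc.norm_approxOn_zero_le hgm (Set.mem_univ (0 : ℂ)) x n
  have hFl : ∀ x, Tendsto (fun n => F n x) atTop (nhds (f x)) := fun x =>
    SimpleFunc.tendsto_approxOn hfm (Set.mem_univ (0 : ℂ)) (by simp)
  have hGl : ∀ x, Tendsto (fun n => G n x) atTop (nhds (g x)) := fun x =>
    SimpleFunc.tendsto_approxOn hgm (Set.mem_univ (0 : ℂ)) (by simp)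
  have hFi : ∀ n, Integrable (F n) := fun n =>
    (hf.norm.const_mul 2).mono' (F n).aestronglyMeasurable (Eventually.of_forall (hFb n))
  have hGi : ∀ n, Integrable (G n) := fun n =>
    (hg.norm.const_mul 2).mono' (G n).aestronglyMeasurable (Eventually.of_forall (hGb n))
  have hnorm : ∀ {u v : ℝ × ℝ → ℂ}, (∀ x, ‖u x‖ ≤ 2 * ‖v x‖) → (Integrable fun x => ‖v x‖ ^ q) →
      ∫ x, ‖u x‖ ^ q ≤ 4 * ∫ x, ‖v x‖ ^ q := by
    intro u v huv hv
    rw [← integral_const_mul]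
    refine integral_mono_of_nonneg (Eventually.of_forall fun x => by positivity) (hv.const_mul _)
      (Eventually.of_forall fun x => ?_)
    calc ‖u x‖ ^ q ≤ (2 * ‖v x‖) ^ q := by gcongr; exact huv x
      _ = 2 ^ q * ‖v x‖ ^ q := Real.mul_rpow (by norm_num) (norm_nonneg _)
      _ ≤ 2 ^ (2 : ℝ) * ‖v x‖ ^ q := by gcongr; norm_num
      _ = 4 * ‖v x‖ ^ q := by norm_num
  have hL1 : ∀ {u v : ℝ × ℝ → ℂ}, (∀ x, ‖u x‖ ≤ 2 * ‖v x‖) → Integrable v →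
      ∫ x, ‖u x‖ ≤ 2 * ∫ x, ‖v x‖ := by
    intro u v huv hv
    rw [← integral_const_mul]
    exact integral_mono_of_nonneg (Eventually.of_forall fun x => norm_nonneg _) (hv.norm.const_mul _)
      (Eventually.of_forall huv)
  have hlim : Tendsto (fun n => famPair α t δ a b (α / 2 - ε) θ (F n) (G n)) atTop
      (nhds (famPair α t δ a b (α / 2 - ε) θ f g)) := by
    refine tendsto_integral_of_dominated_convergence
      (fun p => ‖famSymbol α t δ a b (α / 2 - ε) θ p‖ * ((2 * ∫ x, ‖f x‖) * (2 * ∫ x, ‖g x‖)))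
      (fun n => (integrable_famSymbol_mul hδ ha _ (hFi n) (hGi n)).aestronglyMeasurable)
      ((integrable_famSymbol hδ ha _).norm.mul_const _) (fun n => Eventually.of_forall fun p => ?_)
      (Eventually.of_forall fun p => Tendsto.const_mul _ (Tendsto.mul ?_ ?_))
    · rw [norm_mul, norm_mul]
      refine mul_le_mul_of_nonneg_left (mul_le_mul ((norm_FT2_le _ p).trans (hL1 (hFb n) hf))
        ((norm_IFT2_le _ p).trans (hL1 (hGb n) hg)) (norm_nonneg _) ?_) (norm_nonneg _)
      exact mul_nonneg two_pos.le (integral_nonneg fun _ => norm_nonneg _)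
    · exact tendsto_FT2_of_dominated (fun n => (F n).aestronglyMeasurable) (hf.norm.const_mul 2)
        hFb hFl p
    · simp_rw [IFT2_eq_FT2_neg]
      exact tendsto_FT2_of_dominated (fun n => (G n).aestronglyMeasurable) (hg.norm.const_mul 2)
        hGb hGl (-p)
  refine le_of_tendsto hlim.norm (Eventually.of_forall fun n => ?_)
  refine (norm_famPair_simple_le hε hε1 hα hα2 ht hδ ha hab hθ hθ1 hq (hFi n) (hGi n)).trans ?_
  have hf0 : 0 ≤ ∫ x, ‖f x‖ ^ q := integral_nonneg fun _ => by positivity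
  have hg0 : 0 ≤ ∫ x, ‖g x‖ ^ q := integral_nonneg fun _ => by positivity
  have hF0 : 0 ≤ ∫ x, ‖F n x‖ ^ q := integral_nonneg fun _ => by positivity
  have hG0 : 0 ≤ ∫ x, ‖G n x‖ ^ q := integral_nonneg fun _ => by positivity
  have h1 : ((∫ x, ‖F n x‖ ^ q) * ∫ x, ‖G n x‖ ^ q) ^ (1 / q) ≤
      16 * ((∫ x, ‖f x‖ ^ q) * ∫ x, ‖g x‖ ^ q) ^ (1 / q) := by
    calc _ ≤ (16 * ((∫ x, ‖f x‖ ^ q) * ∫ x, ‖g x‖ ^ q)) ^ (1 / q) := by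
          refine Real.rpow_le_rpow (mul_nonneg hF0 hG0) ?_ (by positivity)
          calc _ ≤ (4 * ∫ x, ‖f x‖ ^ q) * (4 * ∫ x, ‖g x‖ ^ q) :=
                mul_le_mul (hnorm (hFb n) hfq) (hnorm (hGb n) hgq) hG0 (by positivity)
            _ = _ := by ring
      _ = 16 ^ (1 / q) * ((∫ x, ‖f x‖ ^ q) * ∫ x, ‖g x‖ ^ q) ^ (1 / q) :=
          Real.mul_rpow (by norm_num) (mul_nonneg hf0 hg0)
      _ ≤ 16 ^ (1 : ℝ) * ((∫ x, ‖f x‖ ^ q) * ∫ x, ‖g x‖ ^ q) ^ (1 / q) := by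
          gcongr
          · norm_num
          · rw [div_le_one (by linarith)]
            exact hq1
      _ = _ := by rw [Real.rpow_one]
  refine (mul_le_mul_of_nonneg_left h1 (by positivity)).trans (le_of_eq (by ring))

/-- The interpolated bound for the bilinear form, uniform in the truncation parameters. -/
theorem norm_famPair_le {α t δ ε a b θ : ℝ} (hε : 0 < ε) (hε1 : ε < 1) (hα : -1 ≤ α)
    (hα2 : α ≤ 1) (ht : t ≠ 0) (hδ : 0 < δ) (ha : 0 < a) (hab : a ≤ b) (hθ : 0 ≤ θ) (hθ1 : θ ≤ 1)
    {q : ℝ} (hq : q * (1 + θ) = 2) {f g : ℝ × ℝ → ℂ} (hf : Integrable f) (hg : Integrable g)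
    (hfq : Integrable fun x => ‖f x‖ ^ q) (hgq : Integrable fun x => ‖g x‖ ^ q) :
    ‖famPair α t δ a b (α / 2 - ε) θ f g‖ ≤
      16 * Real.exp 1 * (8 * √Real.pi * (1 / (1 - ε) + 88 + 44 / ε)) ^ θ *
        |t| ^ (-(θ * (5 - 2 * ε)) / 6) * ((∫ x, ‖f x‖ ^ q) * ∫ x, ‖g x‖ ^ q) ^ (1 / q) := by
  have ef := hf.1.ae_eq_mk
  have eg := hg.1.ae_eq_mk
  have eqf : (fun x => ‖f x‖ ^ q) =ᵐ[volume] fun x => ‖hf.1.mk f x‖ ^ q := ef.mono fun x hx => by simp only [hx]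
  have eqg : (fun x => ‖g x‖ ^ q) =ᵐ[volume] fun x => ‖hg.1.mk g x‖ ^ q := eg.mono fun x hx => by simp only [hx]
  have h := norm_famPair_le_of_measurable hε hε1 hα hα2 ht hδ ha hab hθ hθ1 hq (hf.congr ef) (hg.congr eg)
    hf.1.stronglyMeasurable_mk.measurable hg.1.stronglyMeasurable_mk.measurable (hfq.congr eqf) (hgq.congr eqg)
  rw [← integral_congr_ae eqf, ← integral_congr_ae eqg] at h
  unfold famPair at h ⊢
  simp_rw [IFT2_eq_FT2_neg] at h ⊢
  rwa [← FT2_congr_ae ef, ← FT2_congr_ae eg] at h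

theorem ae_fst_ne_zero : ∀ᵐ p : ℝ × ℝ, p.1 ≠ 0 :=
  Measure.quasiMeasurePreserving_fst.ae (Measure.ae_ne volume (0 : ℝ))

theorem continuousAt_groupSymbol (α t : ℝ) {p : ℝ × ℝ} (hp : p.1 ≠ 0) :
    ContinuousAt (groupSymbol α t) p := by
  have hs : ContinuousAt (fun p : ℝ × ℝ => Real.sign p.1) p := by
    rcases lt_or_gt_of_ne hp with h | h
    · refine (continuousAt_const (y := (-1 : ℝ))).congr ?_
      filter_upwards [(isOpen_Iio.preimage continuous_fst).mem_nhds h] with x hx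
      exact (Real.sign_of_neg hx).symm
    · refine (continuousAt_const (y := (1 : ℝ))).congr ?_
      filter_upwards [(isOpen_Ioi.preimage continuous_fst).mem_nhds h] with x hx
      exact (Real.sign_of_pos hx).symm
  have ha : ContinuousAt (fun p : ℝ × ℝ => |p.1| ^ α) p :=
    continuous_fst.abs.continuousAt.rpow_const (Or.inl (abs_ne_zero.2 hp))
  unfold groupSymbol
  refine Complex.continuous_exp.continuousAt.comp (continuousAt_const.mul
    (Complex.continuous_ofReal.continuousAt.comp ?_))
  exact (continuous_fst.pow 3).continuousAt.add ((hs.mul ha).mul (continuous_snd.pow 2).continuousAt)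

theorem IFT2_congr_ae {f g : ℝ × ℝ → ℂ} (h : f =ᵐ[volume] g) : IFT2 f = IFT2 g := by
  funext p
  exact integral_congr_ae (h.mono fun x hx => by simp only [hx])

theorem IFT2_zero : IFT2 (fun _ => 0) = 0 := by
  funext x
  simp [IFT2]

theorem FT2_zero : FT2 (fun _ => 0) = 0 := by
  funext x
  simp [FT2]

/-- Either `D_x^s W_α(t) ψ` vanishes because one of the integrals involved diverges, or it is an
absolutely convergent oscillatory integral. -/
theorem Dx_Wgrp_eq (α t s : ℝ) (ψ : ℝ × ℝ → ℂ) :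
    Dx s (Wgrp α t ψ) = 0 ∨ (Integrable ψ ∧
      Integrable (fun p : ℝ × ℝ => ((|p.1| ^ s : ℝ) : ℂ) * (groupSymbol α t p * FT2 ψ p)) ∧
      Dx s (Wgrp α t ψ) =
        IFT2 fun p => ((|p.1| ^ s : ℝ) : ℂ) * (groupSymbol α t p * FT2 ψ p)) := by
  have hW : Wgrp α t ψ = IFT2 fun p => groupSymbol α t p * FT2 ψ p := rfl
  have hDx0 : ∀ {u : ℝ × ℝ → ℂ}, FT2 u = 0 → Dx s u = 0 := fun {u} hu => by
    simp only [Dx, hu, Pi.zero_apply, mul_zero]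
    exact IFT2_zero
  by_cases hψ : Integrable ψ
  swap
  · left
    apply hDx0
    rw [hW, FT2_eq_zero_of_not_integrable hψ]
    simp only [Pi.zero_apply, mul_zero]
    rw [IFT2_zero]
    exact FT2_zero
  by_cases hG : Integrable fun p => groupSymbol α t p * FT2 ψ p
  swap
  · left
    apply hDx0
    rw [hW, IFT2_eq_zero_of_not_integrable hG]
    exact FT2_zero
  by_cases hI : Integrable (IFT2 fun p => groupSymbol α t p * FT2 ψ p)
  swap
  · left
    apply hDx0
    rw [hW, FT2_eq_zero_of_not_integrable hI]
  have heq : Dx s (Wgrp α t ψ) =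
      IFT2 fun p => ((|p.1| ^ s : ℝ) : ℂ) * (groupSymbol α t p * FT2 ψ p) := by
    refine IFT2_congr_ae (ae_fst_ne_zero.mono fun p hp => ?_)
    simp only
    rw [hW, FT2_IFT2_of_continuousAt hG hI
      ((continuousAt_groupSymbol α t hp).mul (continuous_FT2 hψ).continuousAt)]
  by_cases hS : Integrable
      (fun p : ℝ × ℝ => ((|p.1| ^ s : ℝ) : ℂ) * (groupSymbol α t p * FT2 ψ p))
  · exact Or.inr ⟨hψ, hS, heq⟩
  · left
    rw [heq, IFT2_eq_zero_of_not_integrable hS]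

theorem norm_famSymbol_ofReal_le {α t δ a b σ : ℝ} (hδ : 0 ≤ δ) (ha : 0 < a) (θ : ℝ) (p : ℝ × ℝ) :
    ‖famSymbol α t δ a b σ θ p‖ ≤ |p.1| ^ (θ * σ) := by
  by_cases hp : p ∈ freqShell a b
  · have hp0 : 0 < |p.1| := ha.trans_le hp.1
    rw [famSymbol, norm_mul, Complex.norm_cpow_eq_rpow_re_of_pos hp0]
    have h1 : ((θ : ℂ) * (σ : ℂ)).re = θ * σ := by simp
    rw [h1]
    exact mul_le_of_le_one_right (by positivity) (norm_regSymbol_le_one hδ p)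
  · rw [famSymbol, regSymbol_eq_zero hp, mul_zero, norm_zero]
    positivity

theorem tendsto_famSymbol (α t σ θ : ℝ) {p : ℝ × ℝ} (hp : p.1 ≠ 0) :
    Tendsto (fun n : ℕ => famSymbol α t (1 / ((n : ℝ) + 1)) (1 / ((n : ℝ) + 1)) ((n : ℝ) + 1) σ θ p)
      atTop (nhds (((|p.1| ^ (θ * σ) : ℝ) : ℂ) * groupSymbol α t p)) := by
  have hp0 : 0 < |p.1| := abs_pos.2 hp
  have hpow : ((|p.1| ^ (θ * σ) : ℝ) : ℂ) = ((|p.1| : ℝ) : ℂ) ^ ((θ : ℂ) * (σ : ℂ)) := by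
    rw [Complex.ofReal_cpow hp0.le, Complex.ofReal_mul]
  rw [hpow]
  refine Tendsto.const_mul _ ?_
  have hlim := tendsto_one_div_add_atTop_nhds_zero_nat (𝕜 := ℝ)
  have hev : ∀ᶠ n : ℕ in atTop, p ∈ freqShell (1 / ((n : ℝ) + 1)) ((n : ℝ) + 1) := by
    filter_upwards [hlim.eventually (eventually_le_nhds hp0),
      (tendsto_natCast_atTop_atTop (R := ℝ)).eventually_ge_atTop |p.1|] with n h1 h2
    exact ⟨h1, by linarith⟩
  have hexp : Tendsto (fun n : ℕ => ((Real.exp (-(1 / ((n : ℝ) + 1) * |p.1| ^ α * p.2 ^ 2)) : ℝ) : ℂ) *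
      groupSymbol α t p) atTop (nhds (groupSymbol α t p)) := by
    have h : Tendsto (fun n : ℕ => Real.exp (-(1 / ((n : ℝ) + 1) * |p.1| ^ α * p.2 ^ 2))) atTop
        (nhds (Real.exp (-(0 * |p.1| ^ α * p.2 ^ 2)))) :=
      (Real.continuous_exp.tendsto _).comp ((hlim.mul_const _).mul_const _).neg
    simp only [zero_mul, neg_zero, Real.exp_zero] at h
    simpa using ((Complex.continuous_ofReal.tendsto _).comp h).mul_const (groupSymbol α t p)
  refine hexp.congr' (hev.mono fun n hn => ?_)
  simp only [regSymbol, Set.indicator_of_mem hn]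

theorem tendsto_integral_famSymbol_mul (α t σ θ : ℝ) {H : ℝ × ℝ → ℂ} (hHm : AEStronglyMeasurable H)
    (hH : Integrable fun p : ℝ × ℝ => ((|p.1| ^ (θ * σ) : ℝ) : ℂ) * (groupSymbol α t p * H p)) :
    Tendsto (fun n : ℕ => ∫ p, famSymbol α t (1 / ((n : ℝ) + 1)) (1 / ((n : ℝ) + 1)) ((n : ℝ) + 1) σ θ p
      * H p) atTop
      (nhds (∫ p : ℝ × ℝ, ((|p.1| ^ (θ * σ) : ℝ) : ℂ) * (groupSymbol α t p * H p))) := by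
  refine tendsto_integral_of_dominated_convergence _
    (fun n => (measurable_famSymbol _ _ _ _ _ _ _).aestronglyMeasurable.mul hHm) hH.norm
    (fun n => Eventually.of_forall fun p => ?_) (ae_fst_ne_zero.mono fun p hp => ?_)
  · rw [norm_mul, norm_mul, norm_mul, norm_groupSymbol, one_mul, Complex.norm_real,
      Real.norm_of_nonneg (by positivity)]
    exact mul_le_mul_of_nonneg_right
      (norm_famSymbol_ofReal_le (by positivity) (by positivity) θ p) (norm_nonneg _)
  · rw [← mul_assoc]
    exact (tendsto_famSymbol α t σ θ hp).mul_const _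

/-- The dispersive endpoint `L¹ → L^∞`. -/
theorem norm_IFT2_dispersive_le {α t ε : ℝ} (hε : 0 < ε) (hε1 : ε < 1) (hα : -1 ≤ α)
    (hα2 : α ≤ 1) (ht : t ≠ 0) {ψ : ℝ × ℝ → ℂ} (hψ : Integrable ψ)
    (hS : Integrable fun p : ℝ × ℝ =>
      ((|p.1| ^ (1 * (α / 2 - ε)) : ℝ) : ℂ) * (groupSymbol α t p * FT2 ψ p)) (x : ℝ × ℝ) :
    ‖IFT2 (fun p => ((|p.1| ^ (1 * (α / 2 - ε)) : ℝ) : ℂ) * (groupSymbol α t p * FT2 ψ p)) x‖ ≤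
      4 * √Real.pi * (1 / (1 - ε) + 88 + 44 / ε) * |t| ^ (-(5 - 2 * ε) / 6) * ∫ y, ‖ψ y‖ := by
  have hcomm : ∀ p : ℝ × ℝ,
      ((|p.1| ^ (1 * (α / 2 - ε)) : ℝ) : ℂ) * (groupSymbol α t p *
        (Complex.exp (((2 * Real.pi * (x.1 * p.1 + x.2 * p.2) : ℝ) : ℂ) * Complex.I) * FT2 ψ p)) =
      Complex.exp (((2 * Real.pi * (x.1 * p.1 + x.2 * p.2) : ℝ) : ℂ) * Complex.I) *
        (((|p.1| ^ (1 * (α / 2 - ε)) : ℝ) : ℂ) * (groupSymbol α t p * FT2 ψ p)) := fun p => by ring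
  have hlim := tendsto_integral_famSymbol_mul α t (α / 2 - ε) 1
    (H := fun p => Complex.exp (((2 * Real.pi * (x.1 * p.1 + x.2 * p.2) : ℝ) : ℂ) * Complex.I) *
      FT2 ψ p) (Continuous.mul (by fun_prop) (continuous_FT2 hψ)).aestronglyMeasurable (by
      simp_rw [hcomm]
      exact (integrable_phase_mul_iff x).2 hS)
  simp_rw [hcomm] at hlim
  refine le_of_tendsto hlim.norm (Eventually.of_forall fun n => ?_)
  have hn : 0 < 1 / ((n : ℝ) + 1) := by positivity
  have hab : 1 / ((n : ℝ) + 1) ≤ (n : ℝ) + 1 := by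
    rw [div_le_iff₀ (by positivity)]
    nlinarith [(Nat.cast_nonneg n : (0 : ℝ) ≤ n)]
  have hK : ∀ w, ‖IFT2 (famSymbol α t (1 / ((n : ℝ) + 1)) (1 / ((n : ℝ) + 1)) ((n : ℝ) + 1)
      (α / 2 - ε) ((1 : ℝ) : ℂ)) w‖ ≤
      4 * √Real.pi * (1 / (1 - ε) + 88 + 44 / ε) * |t| ^ (-(5 - 2 * ε) / 6) := fun w => by
    have h := norm_IFT2_famSymbol_le hε hε1 hα hα2 ht hn hn hab 0 w
    simpa using h
  have h := norm_IFT2_mul_FT2_le (integrable_famSymbol hn hn _) hψ hK x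
  refine le_of_eq_of_le (congrArg norm (integral_congr_ae (Eventually.of_forall fun p => ?_))) h
  simp only
  ring

theorem norm_integral_IFT2_mul_le {α t ε θ : ℝ} (hε : 0 < ε) (hε1 : ε < 1) (hα : -1 ≤ α)
    (hα2 : α ≤ 1) (ht : t ≠ 0) (hθ : 0 ≤ θ) (hθ1 : θ ≤ 1) {q : ℝ} (hq : q * (1 + θ) = 2)
    {ψ g : ℝ × ℝ → ℂ} (hψ : Integrable ψ) (hψq : Integrable fun x => ‖ψ x‖ ^ q)
    (hS : Integrable fun p : ℝ × ℝ =>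
      ((|p.1| ^ (θ * (α / 2 - ε)) : ℝ) : ℂ) * (groupSymbol α t p * FT2 ψ p))
    (hg : Integrable g) (hgq : Integrable fun x => ‖g x‖ ^ q) :
    ‖∫ x, IFT2 (fun p => ((|p.1| ^ (θ * (α / 2 - ε)) : ℝ) : ℂ) * (groupSymbol α t p * FT2 ψ p)) x
        * g x‖ ≤
      16 * Real.exp 1 * (8 * √Real.pi * (1 / (1 - ε) + 88 + 44 / ε)) ^ θ *
        |t| ^ (-(θ * (5 - 2 * ε)) / 6) * ((∫ x, ‖ψ x‖ ^ q) * ∫ x, ‖g x‖ ^ q) ^ (1 / q) := by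
  rw [integral_IFT2_mul hS hg]
  have hcomm : ∀ p : ℝ × ℝ, ((|p.1| ^ (θ * (α / 2 - ε)) : ℝ) : ℂ) *
      (groupSymbol α t p * (FT2 ψ p * IFT2 g p)) =
      ((|p.1| ^ (θ * (α / 2 - ε)) : ℝ) : ℂ) * (groupSymbol α t p * FT2 ψ p) * IFT2 g p :=
    fun p => by ring
  have hlim := tendsto_integral_famSymbol_mul α t (α / 2 - ε) θ
    (H := fun p => FT2 ψ p * IFT2 g p)
    ((continuous_FT2 hψ).mul (continuous_IFT2 hg)).aestronglyMeasurable (by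
      simp_rw [hcomm]
      exact hS.mul_bdd (c := ∫ x, ‖g x‖) (continuous_IFT2 hg).aestronglyMeasurable
        (Eventually.of_forall (norm_IFT2_le g)))
  simp_rw [hcomm] at hlim
  refine le_of_tendsto hlim.norm (Eventually.of_forall fun n => ?_)
  have hn : 0 < 1 / ((n : ℝ) + 1) := by positivity
  have hab : 1 / ((n : ℝ) + 1) ≤ (n : ℝ) + 1 := by
    rw [div_le_iff₀ (by positivity)]
    nlinarith [(Nat.cast_nonneg n : (0 : ℝ) ≤ n)]
  exact norm_famPair_le hε hε1 hα hα2 ht hn hn hab hθ hθ1 hq hψ hg hψq hgq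

/-- A continuous function whose pairing with every `g ∈ L¹ ∩ L^q` is bounded by `A ‖g‖_q` lies in
the dual space `L^r`, with norm at most `A`. -/
theorem eLpNorm_le_of_pairing_le {v : ℝ × ℝ → ℂ} (hv : Continuous v) {r q A : ℝ} (hA : 0 ≤ A)
    (hrq : r.HolderConjugate q)
    (hpair : ∀ g : ℝ × ℝ → ℂ, Integrable g → (Integrable fun x => ‖g x‖ ^ q) →
      ‖∫ x, v x * g x‖ ≤ A * (∫ x, ‖g x‖ ^ q) ^ (1 / q)) :
    eLpNorm v (ENNReal.ofReal r) volume ≤ ENNReal.ofReal A := by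
  have hr0 : 0 < r := hrq.pos
  have hq0 : 0 < q := hrq.symm.pos
  have hr1 : 1 < r := hrq.lt
  have hball : ∀ n : ℕ, ∫⁻ x in Metric.closedBall (0 : ℝ × ℝ) n, ‖v x‖ₑ ^ r ≤
      ENNReal.ofReal A ^ r := by
    intro n
    set B := Metric.closedBall (0 : ℝ × ℝ) n
    have hB : MeasurableSet B := measurableSet_closedBall
    set h : ℝ × ℝ → ℂ := fun x => (starRingEnd ℂ) (v x) * ((‖v x‖ ^ (r - 2) : ℝ) : ℂ) with hh
    have hnorm : ∀ x, ‖h x‖ = ‖v x‖ ^ (r - 1) := fun x => by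
      rw [hh]
      simp only [norm_mul, RCLike.norm_conj, Complex.norm_real]
      rw [Real.norm_of_nonneg (by positivity)]
      rcases (norm_nonneg (v x)).eq_or_lt with h0 | h0
      · rw [← h0, zero_mul, Real.zero_rpow (by linarith)]
      · nth_rewrite 1 [← Real.rpow_one ‖v x‖]
        rw [← Real.rpow_add h0]
        ring_nf
    have hmul : ∀ x, v x * h x = ((‖v x‖ ^ r : ℝ) : ℂ) := fun x => by
      rw [hh]
      simp only
      rw [← mul_assoc, Complex.mul_conj, Complex.normSq_eq_norm_sq, ← Complex.ofReal_mul]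
      congr 1
      rcases (norm_nonneg (v x)).eq_or_lt with h0 | h0
      · rw [← h0, Real.zero_rpow hr0.ne']
        simp
      · rw [← Real.rpow_natCast, ← Real.rpow_add h0]
        norm_num
    have hhq : ∀ x, ‖h x‖ ^ q = ‖v x‖ ^ r := fun x => by
      rw [hnorm, ← Real.rpow_mul (norm_nonneg _), hrq.sub_one_mul_conj]
    have hhm : Measurable h := by
      have := hv.measurable
      have h1 : Measurable fun x => (starRingEnd ℂ) (v x) := Complex.continuous_conj.measurable.comp this
      exact h1.mul (Complex.measurable_ofReal.comp (this.norm.pow_const _))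
    have hvr : Continuous fun x => ‖v x‖ ^ r := hv.norm.rpow_const fun _ => Or.inr hr0.le
    have hvr1 : Continuous fun x => ‖v x‖ ^ (r - 1) := hv.norm.rpow_const fun _ => Or.inr (by linarith)
    have h_int : IntegrableOn (fun x => ‖v x‖ ^ r) B :=
      hvr.continuousOn.integrableOn_compact (isCompact_closedBall _ _)
    have hint1 : IntegrableOn (fun x => ‖v x‖ ^ (r - 1)) B :=
      hvr1.continuousOn.integrableOn_compact (isCompact_closedBall _ _)
    have hgi : Integrable (B.indicator h) := by
      rw [integrable_indicator_iff hB]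
      exact hint1.mono' hhm.aestronglyMeasurable (Eventually.of_forall fun x => (hnorm x).le)
    have hgq : (fun x => ‖B.indicator h x‖ ^ q) = B.indicator fun x => ‖v x‖ ^ r := by
      funext x
      by_cases hx : x ∈ B
      · rw [Set.indicator_of_mem hx, Set.indicator_of_mem hx, hhq]
      · rw [Set.indicator_of_notMem hx, Set.indicator_of_notMem hx, norm_zero, Real.zero_rpow hq0.ne']
    have hvg : (fun x => v x * B.indicator h x) = B.indicator fun x => ((‖v x‖ ^ r : ℝ) : ℂ) := by
      funext x
      by_cases hx : x ∈ B
      · rw [Set.indicator_of_mem hx, Set.indicator_of_mem hx, hmul]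
      · rw [Set.indicator_of_notMem hx, Set.indicator_of_notMem hx, mul_zero]
    have key := hpair _ hgi (by rw [hgq]; exact (integrable_indicator_iff hB).2 h_int)
    rw [hgq, hvg, integral_indicator hB, integral_indicator hB, integral_complex_ofReal,
      Complex.norm_real] at key
    set J := ∫ x in B, ‖v x‖ ^ r
    have hJ : 0 ≤ J := integral_nonneg fun _ => by positivity
    rw [Real.norm_of_nonneg hJ] at key
    have hJA : J ≤ A ^ r := by
      rcases hJ.eq_or_lt with h0 | h0
      · rw [← h0]
        positivity
      · have h1 : J ^ (1 / r) ≤ A := by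
          have h2 : J = J ^ (1 / r) * J ^ (1 / q) := by
            rw [← Real.rpow_add h0, one_div, one_div, hrq.inv_add_inv_eq_one, Real.rpow_one]
          have h3 : 0 < J ^ (1 / q) := by positivity
          rw [h2, ← h2] at key
          refine le_of_mul_le_mul_right ?_ h3
          rwa [← h2]
        calc J = (J ^ (1 / r)) ^ r := by
              rw [← Real.rpow_mul hJ, one_div, inv_mul_cancel₀ hr0.ne', Real.rpow_one]
          _ ≤ A ^ r := by gcongr
    have hconv : ∫⁻ x in B, ‖v x‖ₑ ^ r = ENNReal.ofReal J := by
      rw [ofReal_integral_eq_lintegral_ofReal h_int (Eventually.of_forall fun _ => by positivity)]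
      refine lintegral_congr fun x => ?_
      rw [← ENNReal.ofReal_rpow_of_nonneg (norm_nonneg _) hr0.le, ofReal_norm]
    rw [hconv, ENNReal.ofReal_rpow_of_nonneg hA hr0.le]
    exact ENNReal.ofReal_le_ofReal hJA
  have hcov : AECover volume atTop fun n : ℕ => Metric.closedBall (0 : ℝ × ℝ) n :=
    aecover_closedBall tendsto_natCast_atTop_atTop
  have htot : ∫⁻ x, ‖v x‖ₑ ^ r ≤ ENNReal.ofReal A ^ r :=
    le_of_tendsto' (hcov.lintegral_tendsto_of_countably_generated
      (hv.measurable.enorm.pow_const r).aemeasurable) hball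
  rw [eLpNorm_eq_lintegral_rpow_enorm_toReal (by simpa using hr0) ENNReal.ofReal_ne_top,
    ENNReal.toReal_ofReal hr0.le]
  calc _ ≤ (ENNReal.ofReal A ^ r) ^ (1 / r) := ENNReal.rpow_le_rpow htot (by positivity)
    _ = _ := by rw [← ENNReal.rpow_mul, mul_one_div_cancel hr0.ne', ENNReal.rpow_one]

theorem stmt9 (α ε θ : ℝ) (hα1 : -1 ≤ α) (hα2 : α ≤ 1) (hε1 : 0 < ε) (hε2 : ε < 1)
    (hθ1 : 0 ≤ θ) (hθ2 : θ ≤ 1) (p p' : ℝ≥0∞)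
    (hp : 1 / p = ENNReal.ofReal ((1 - θ) / 2)) (hpp' : 1 / p + 1 / p' = 1) :
    ∃ C > 0, ∀ ψ : ℝ × ℝ → ℂ, ∀ t : ℝ, t ≠ 0 →
      eLpNorm (Dx (θ * (α / 2 - ε)) (Wgrp α t ψ)) p volume ≤
        ENNReal.ofReal (C * |t| ^ (-(θ * (5 - 2 * ε)) / 6)) * eLpNorm ψ p' volume := by
  have hε3 : 0 < 1 - ε := by linarith
  have hX : 0 < 1 / (1 - ε) + 88 + 44 / ε := by positivity
  have hp' : p' = ENNReal.ofReal (2 / (1 + θ)) := by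
    have h1 : (1 : ℝ≥0∞) = ENNReal.ofReal ((1 - θ) / 2) + ENNReal.ofReal ((1 + θ) / 2) := by
      rw [← ENNReal.ofReal_add (by linarith) (by linarith), ← ENNReal.ofReal_one]
      congr 1
      ring
    rw [hp] at hpp'
    have h2 := (ENNReal.add_right_inj ENNReal.ofReal_ne_top).1 (hpp'.trans h1)
    rw [one_div] at h2
    rw [← inv_inv p', h2, ← ENNReal.ofReal_inv_of_pos (by linarith), inv_div]
  have hq : 2 / (1 + θ) * (1 + θ) = 2 := div_mul_cancel₀ _ (by linarith)
  have hq0 : 0 < 2 / (1 + θ) := by positivity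
  refine ⟨16 * Real.exp 1 * (8 * √Real.pi * (1 / (1 - ε) + 88 + 44 / ε)) ^ θ, by positivity,
    fun ψ t ht => ?_⟩
  have ht0 : 0 < |t| := abs_pos.2 ht
  have hpos : 0 < 16 * Real.exp 1 * (8 * √Real.pi * (1 / (1 - ε) + 88 + 44 / ε)) ^ θ *
      |t| ^ (-(θ * (5 - 2 * ε)) / 6) := by positivity
  by_cases htop : eLpNorm ψ p' volume = ⊤
  · rw [htop, ENNReal.mul_top (ENNReal.ofReal_pos.2 hpos).ne']
    exact le_top
  rcases Dx_Wgrp_eq α t (θ * (α / 2 - ε)) ψ with h0 | ⟨hψ, hS, heq⟩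
  · rw [h0, eLpNorm_zero]
    exact zero_le
  rw [heq]
  have hmem : MemLp ψ (ENNReal.ofReal (2 / (1 + θ))) volume :=
    ⟨hψ.1, by rw [← hp']; exact lt_top_iff_ne_top.2 htop⟩
  have hψq : Integrable fun x => ‖ψ x‖ ^ (2 / (1 + θ)) := by
    have h := hmem.integrable_norm_rpow (by simpa using hq0) ENNReal.ofReal_ne_top
    rwa [ENNReal.toReal_ofReal hq0.le] at h
  have hψ0 : 0 ≤ ∫ x, ‖ψ x‖ ^ (2 / (1 + θ)) := integral_nonneg fun _ => by positivity
  have hψe : eLpNorm ψ p' volume =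
      ENNReal.ofReal ((∫ x, ‖ψ x‖ ^ (2 / (1 + θ))) ^ (1 / (2 / (1 + θ)))) := by
    rw [hp', hmem.eLpNorm_eq_integral_rpow_norm (by simpa using hq0) ENNReal.ofReal_ne_top,
      ENNReal.toReal_ofReal hq0.le, one_div]
  rw [hψe, ← ENNReal.ofReal_mul hpos.le]
  rcases hθ2.eq_or_lt with rfl | hlt
  · have hptop : p = ⊤ := by
      rw [sub_self, zero_div, ENNReal.ofReal_zero, one_div] at hp
      exact ENNReal.inv_eq_zero.1 hp
    rw [hptop, eLpNorm_exponent_top]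
    refine eLpNormEssSup_le_of_ae_bound (Eventually.of_forall fun x => ?_)
    refine (norm_IFT2_dispersive_le hε1 hε2 hα1 hα2 ht hψ hS x).trans ?_
    have h2 : (2 : ℝ) / (1 + 1) = 1 := by norm_num
    rw [h2]
    simp only [Real.rpow_one, div_one, one_mul]
    have hI : 0 ≤ ∫ x, ‖ψ x‖ := integral_nonneg fun _ => norm_nonneg _
    have he : (1 : ℝ) ≤ Real.exp 1 := Real.one_le_exp zero_le_one
    have hc : 4 * √Real.pi * (1 / (1 - ε) + 88 + 44 / ε) ≤
        16 * Real.exp 1 * (8 * √Real.pi * (1 / (1 - ε) + 88 + 44 / ε)) := by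
      have hY : 0 < √Real.pi * (1 / (1 - ε) + 88 + 44 / ε) := by positivity
      nlinarith
    gcongr
  · have h1θ : 0 < 1 - θ := by linarith
    have hpr : p = ENNReal.ofReal (2 / (1 - θ)) := by
      rw [one_div] at hp
      rw [← inv_inv p, hp, ← ENNReal.ofReal_inv_of_pos (by linarith), inv_div]
    rw [hpr]
    have hrq : (2 / (1 - θ)).HolderConjugate (2 / (1 + θ)) := by
      rw [Real.holderConjugate_iff]
      refine ⟨?_, ?_⟩
      · rw [lt_div_iff₀ h1θ]
        linarith
      · rw [inv_div, inv_div]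
        ring
    refine eLpNorm_le_of_pairing_le (continuous_IFT2 hS) (by positivity) hrq fun g hg hgq => ?_
    refine (norm_integral_IFT2_mul_le hε1 hε2 hα1 hα2 ht hθ1 hθ2 hq hψ hψq hS hg hgq).trans
      (le_of_eq ?_)
    rw [Real.mul_rpow hψ0 (integral_nonneg fun _ => by positivity)]
    ring
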